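/- arXiv:math/0509117 — 7 statements merged into one kernel-verified Lean document; each statement's English description precedes it below -/
import Mathlib

section
/- Let f : [0,1] → [0,1] be a continuous map. If f has a periodic point of least period n, then for every positive integer m with n ≻ m in the Sharkovskii order, f also has a periodic point of least period m. -/
/-- The Sharkovskii order on positive integers: `SharkovskiiGt n m` means `n ≻ m`.
Writing `n = 2^a * q` and `m = 2^a' * q'` with `q, q'` odd, `n ≻ m` iff
(i) `q > 1`, `q' > 1` and `a < a'`; or (ii) `q > 1`, `q' > 1`, `a = a'` and `q < q'`; or
(iii) `q > 1` and `q' = 1`; or (iv) `q = q' = 1` and `a > a'`. -/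
def SharkovskiiGt (n m : ℕ) : Prop :=
  ∃ a q a' q' : ℕ, Odd q ∧ Odd q' ∧ n = 2 ^ a * q ∧ m = 2 ^ a' * q' ∧
    ((1 < q ∧ 1 < q' ∧ a < a') ∨
     (1 < q ∧ 1 < q' ∧ a = a' ∧ q < q') ∨
     (1 < q ∧ q' = 1) ∨
     (q = 1 ∧ q' = 1 ∧ a' < a))

section

open Function Set

theorem Function.minimalPeriod_eq_of_forall_ne {α : Type*} {f : α → α} {x : α} {n : ℕ}
    (hn : 0 < n) (hx : f^[n] x = x) (h : ∀ k, 1 ≤ k → k < n → f^[k] x ≠ x) :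
    minimalPeriod f x = n := by
  have hp : IsPeriodicPt f n x := hx
  refine (hp.minimalPeriod_le hn).antisymm (not_lt.1 fun hlt => ?_)
  exact h _ (hp.minimalPeriod_pos hn) hlt (isPeriodicPt_minimalPeriod f x)

/-- A stretch of a path from the value `l` to the value `r` that stays between them. -/
theorem exists_uIcc_mapsTo {h : ℝ → ℝ} (hh : Continuous h) {p q l r : ℝ}
    (hl : l ∈ uIcc (h p) (h q)) (hr : r ∈ uIcc (h p) (h q)) :
    ∃ p' ∈ uIcc p q, ∃ q' ∈ uIcc p q, h p' = l ∧ h q' = r ∧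
      MapsTo h (uIcc p' q') (uIcc l r) := by
  -- first treat points `s ≤ t` with values `l` and `r`
  have key : ∀ s t l r : ℝ, s ≤ t → h s = l → h t = r → ∃ p' ∈ Icc s t, ∃ q' ∈ Icc s t,
      h p' = l ∧ h q' = r ∧ MapsTo h (uIcc p' q') (uIcc l r) := by
    intro s t l r hst hs ht
    obtain ⟨p', ⟨hp'm, hp'⟩, hpmax⟩ :=
      (isCompact_Icc.inter_right (isClosed_singleton.preimage hh) :
        IsCompact (Icc s t ∩ h ⁻¹' {l})).exists_isGreatest ⟨s, ⟨le_rfl, hst⟩, hs⟩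
    obtain ⟨q', ⟨hq'm, hq'⟩, hqmin⟩ :=
      (isCompact_Icc.inter_right (isClosed_singleton.preimage hh) :
        IsCompact (Icc p' t ∩ h ⁻¹' {r})).exists_isLeast ⟨t, ⟨hp'm.2, le_rfl⟩, ht⟩
    simp only [mem_preimage, mem_singleton_iff] at hp' hq'
    refine ⟨p', hp'm, q', ⟨hp'm.1.trans hq'm.1, hq'm.2⟩, hp', hq', fun x hx => ?_⟩
    rw [uIcc_of_le hq'm.1] at hx
    by_contra hout
    have hcase : l ∈ uIcc (h x) (h q') ∨ r ∈ uIcc (h p') (h x) := by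
      rw [hp', hq']
      simp only [mem_uIcc] at hout ⊢
      grind
    rcases hcase with hc | hc
    · obtain ⟨w, hw, hwl⟩ := intermediate_value_uIcc hh.continuousOn hc
      rw [uIcc_of_le hx.2] at hw
      have := hpmax ⟨⟨hp'm.1.trans (hx.1.trans hw.1), hw.2.trans hq'm.2⟩, hwl⟩
      have hxp : x = p' := le_antisymm (hw.1.trans this) hx.1
      exact hout (by rw [hxp, hp']; exact left_mem_uIcc)
    · obtain ⟨w, hw, hwl⟩ := intermediate_value_uIcc hh.continuousOn hc
      rw [uIcc_of_le hx.1] at hw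
      have := hqmin ⟨⟨hw.1, hw.2.trans (hx.2.trans hq'm.2)⟩, hwl⟩
      have hxq : x = q' := le_antisymm hx.2 (this.trans hw.2)
      exact hout (by rw [hxq, hq']; exact right_mem_uIcc)
  obtain ⟨s, hs, hsl⟩ := intermediate_value_uIcc hh.continuousOn hl
  obtain ⟨t, ht, htr⟩ := intermediate_value_uIcc hh.continuousOn hr
  have hsub := uIcc_subset_uIcc hs ht
  rcases le_total s t with hst | hst
  · obtain ⟨p', hp', q', hq', h1, h2, h3⟩ := key s t l r hst hsl htr
    rw [← uIcc_of_le hst] at hp' hq'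
    exact ⟨p', hsub hp', q', hsub hq', h1, h2, h3⟩
  · obtain ⟨p', hp', q', hq', h1, h2, h3⟩ := key t s r l hst htr hsl
    rw [← uIcc_of_ge hst] at hp' hq'
    exact ⟨q', hsub hq', p', hsub hp', h2, h1, by rwa [uIcc_comm, uIcc_comm l]⟩

/-- A closed chain of intervals, each stretched by `f` over the next one, is followed by a
periodic orbit of `f`. -/
theorem exists_iterate_eq_of_chain {f : ℝ → ℝ} (hf : Continuous f) (l r : ℕ → ℝ) (n : ℕ)
    (h : ∀ j < n, l (j + 1) ∈ uIcc (f (l j)) (f (r j)) ∧ r (j + 1) ∈ uIcc (f (l j)) (f (r j)))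
    (hl : l 0 ∈ uIcc (l n) (r n)) (hr : r 0 ∈ uIcc (l n) (r n)) :
    ∃ y, f^[n] y = y ∧ ∀ j ≤ n, f^[j] y ∈ uIcc (l j) (r j) := by
  have key : ∀ k ≤ n, ∃ p ∈ uIcc (l 0) (r 0), ∃ q ∈ uIcc (l 0) (r 0), f^[k] p = l k ∧
      f^[k] q = r k ∧ ∀ j ≤ k, MapsTo f^[j] (uIcc p q) (uIcc (l j) (r j)) := by
    intro k
    induction k with
    | zero =>
      intro _
      refine ⟨l 0, left_mem_uIcc, r 0, right_mem_uIcc, rfl, rfl, fun j hj => ?_⟩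
      obtain rfl : j = 0 := by omega
      exact mapsTo_id _
    | succ k ih =>
      intro hk
      obtain ⟨p, hp, q, hq, hpl, hqr, hm⟩ := ih (by omega)
      obtain ⟨h1, h2⟩ := h k hk
      rw [← hpl, ← hqr, ← iterate_succ_apply' f, ← iterate_succ_apply' f] at h1 h2
      obtain ⟨p', hp', q', hq', h3, h4, h5⟩ := exists_uIcc_mapsTo (hf.iterate (k + 1)) h1 h2
      have hsub := uIcc_subset_uIcc hp hq
      refine ⟨p', hsub hp', q', hsub hq', h3, h4, fun j hj => ?_⟩
      rcases Nat.lt_or_ge k j with hjk | hjk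
      · obtain rfl : j = k + 1 := by omega
        exact h5
      · exact (hm j hjk).mono_left (uIcc_subset_uIcc hp' hq')
  obtain ⟨p, hp, q, hq, hpl, hqr, hm⟩ := key n le_rfl
  have hsub := uIcc_subset_uIcc hl hr
  have hp := hsub hp
  have hq := hsub hq
  have h0 : (0 : ℝ) ∈ uIcc (f^[n] p - p) (f^[n] q - q) := by
    rw [hpl, hqr]
    simp only [mem_uIcc] at hp hq ⊢
    grind
  obtain ⟨y, hy, hy0⟩ := intermediate_value_uIcc (f := fun x => f^[n] x - x)
    ((hf.iterate n).sub continuous_id).continuousOn h0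
  exact ⟨y, by simpa [sub_eq_zero] using hy0, fun j hj => hm j hj hy⟩

theorem Function.minimalPeriod_neg_conj (f : ℝ → ℝ) (x : ℝ) :
    minimalPeriod (fun t => -f (-t)) x = minimalPeriod f (-x) := by
  have hs : Semiconj (fun t : ℝ => -t) (fun t => -f (-t)) f := fun t => by simp
  refine minimalPeriod_eq_minimalPeriod_iff.2 fun n => ?_
  have := (hs.iterate_right n) x
  simp only [IsPeriodicPt, IsFixedPt] at this ⊢
  rw [← this, neg_inj]

/-- A closed chain of intervals that changes sides of a fixed point `z` at every step but the
last one gives a periodic point of the (odd) length of the chain. -/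
theorem exists_minimalPeriod_eq_of_alternating {f : ℝ → ℝ} (hf : Continuous f) {z d : ℝ}
    (hz : f z = z) (u : ℕ → ℝ) {N : ℕ} (hN : Even N) (hN0 : 0 < N)
    (hev : ∀ j ≤ N, Even j → u j < z) (hod : ∀ j ≤ N, Odd j → z < u j)
    (hstep : ∀ j < N, u (j + 1) ∈ uIcc z (f (u j))) (hud : u N < d) (hdz : d < z)
    (hd : f d = z) (hlast : u 0 ∈ uIcc z (f (u N))) :
    ∃ y, minimalPeriod f y = N + 1 := by
  obtain ⟨y, hy, hyj⟩ := exists_iterate_eq_of_chain hf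
    (fun j => if j = N then d else z) (fun j => if j = N + 1 then u 0 else u j) (N + 1)
    (by
      intro j hj
      rcases Nat.lt_or_ge j N with hjN | hjN
      · have h1 := hstep j hjN
        rw [if_neg (by omega : j ≠ N), if_neg (by omega : j ≠ N + 1),
          if_neg (by omega : j + 1 ≠ N + 1), hz]
        refine ⟨?_, h1⟩
        split_ifs with hjN'
        · rw [hjN'] at h1
          exact uIcc_subset_uIcc left_mem_uIcc h1 (mem_uIcc.2 (Or.inr ⟨hud.le, hdz.le⟩))
        · exact left_mem_uIcc
      · obtain rfl : j = N := by omega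
        simp only [if_true, hd, Nat.succ_ne_self, if_false, Nat.ne_of_lt (Nat.lt_succ_self j)]
        exact ⟨left_mem_uIcc, hlast⟩)
    (by simp [hN0.ne]) (by simp)
  have hlt : ∀ j ≤ N, f^[j] y ≠ z := by
    intro j hj h
    have h1 : f^[N] y = z := by
      rw [← Nat.sub_add_cancel hj, iterate_add_apply, h, iterate_fixed hz]
    have h2 := hyj N (by omega)
    rw [h1] at h2
    simp only [if_true, Nat.ne_of_lt (Nat.lt_succ_self N), if_false, mem_uIcc] at h2
    grind
  have hside : ∀ j ≤ N, (Even j → f^[j] y < z) ∧ (Odd j → z < f^[j] y) := by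
    intro j hj
    have h2 := hyj j (by omega)
    have h3 : f^[j] y ∈ uIcc z (u j) := by
      rw [if_neg (by omega : j ≠ N + 1)] at h2
      split_ifs at h2 with hjN
      · subst hjN
        exact uIcc_subset_uIcc (mem_uIcc.2 (Or.inr ⟨hud.le, hdz.le⟩)) right_mem_uIcc h2
      · exact h2
    have h4 := hlt j hj
    have h5 := hev j hj
    have h6 := hod j hj
    rw [mem_uIcc] at h3
    constructor <;> intro h7 <;> grind
  refine ⟨y, minimalPeriod_eq_of_forall_ne (by omega) hy fun k hk1 hk2 hk => ?_⟩
  have h0 := (hside 0 (by omega)).1 (by simp)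
  rcases Nat.even_or_odd k with he | ho
  · have h1 : f^[N + 1 - k] y = y := by
      conv_rhs => rw [← hy, ← Nat.sub_add_cancel hk2.le, iterate_add_apply, hk]
    have := (hside (N + 1 - k) (by omega)).2 (by
      rw [Nat.odd_sub hk2.le]; exact iff_of_true hN.add_one he)
    rw [h1] at this
    exact lt_asymm h0 this
  · have := (hside k (by omega)).2 ho
    rw [hk] at this
    exact lt_asymm h0 this

/-- If some point `c` of a transitive invariant set `P` does not change sides of the fixed point
`z`, then `f^[2]` has a horseshoe, so `f` has all even periods. -/
theorem exists_minimalPeriod_eq_two_mul_of_le {f : ℝ → ℝ} (hf : Continuous f) {P : Set ℝ}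
    (hP : MapsTo f P P) (htr : ∀ x ∈ P, ∀ y ∈ P, ∃ j, f^[j] x = y) {a c z : ℝ} (hz : f z = z)
    (ha : a ∈ P) (haz : a < z) (hfa : z < f a) (hsep : ∀ x ∈ P, x ≤ a ∨ z ≤ x)
    (hR : ∀ x ∈ P, z ≤ x → f x ≤ x) (hc : c ∈ P) (hca : c ≤ a) (hfc : f c ≤ z)
    {k : ℕ} (hk : 0 < k) : ∃ y, minimalPeriod f y = 2 * k := by
  have hcl : IsClosed (f ⁻¹' {z}) := isClosed_singleton.preimage hf
  obtain ⟨d, ⟨hdm, hd⟩, hdmax⟩ := (isCompact_Icc.inter_right hcl).exists_isGreatest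
    (intermediate_value_Icc hca hf.continuousOn ⟨hfc, hfa.le⟩)
  obtain ⟨e, ⟨hem, he⟩, hemin⟩ := (isCompact_Icc.inter_right hcl).exists_isLeast
    (⟨z, ⟨haz.le, le_rfl⟩, hz⟩ : (Icc a z ∩ f ⁻¹' {z}).Nonempty)
  simp only [mem_preimage, mem_singleton_iff] at hd he
  have hda : d < a := lt_of_le_of_ne hdm.2 fun h => by rw [h] at hd; exact hfa.ne' hd
  have hge : ∀ x ∈ Icc d e, z ≤ f x := by
    intro x hx
    by_contra! hlt
    rcases le_total x a with hxa | hxa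
    · obtain ⟨w, hw, hwz⟩ := intermediate_value_Icc hxa hf.continuousOn ⟨hlt.le, hfa.le⟩
      have := hdmax ⟨⟨hdm.1.trans (hx.1.trans hw.1), hw.2⟩, hwz⟩
      have hxd : x = d := le_antisymm (hw.1.trans this) hx.1
      rw [hxd, hd] at hlt
      exact hlt.false
    · obtain ⟨w, hw, hwz⟩ := intermediate_value_Icc' hxa hf.continuousOn ⟨hlt.le, hfa.le⟩
      have := hemin ⟨⟨hw.1, hw.2.trans (hx.2.trans hem.2)⟩, hwz⟩
      have hxe : x = e := le_antisymm hx.2 (this.trans hw.2)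
      rw [hxe, he] at hlt
      exact hlt.false
  have hde : d ≤ e := hda.le.trans hem.1
  obtain ⟨v, hv, hvd⟩ : ∃ v ∈ Icc d e, f (f v) ≤ d := by
    by_contra! hno
    obtain ⟨t, ht, htmax⟩ := isCompact_Icc.exists_isMaxOn (nonempty_Icc.2 hde) hf.continuousOn
    have hts : ∀ x ∈ Icc d e, f x ≤ f t := fun x hx => htmax hx
    have hzt : z ≤ f t := hge t ht
    have hinv : ∀ x ∈ P, d < x → x ≤ f t → d < f x ∧ f x ≤ f t := by
      intro x hx hdx hxt
      rcases hsep x hx with hxa | hxz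
      · have hxm : x ∈ Icc d e := ⟨hdx.le, hxa.trans hem.1⟩
        exact ⟨(hda.trans haz).trans_le (hge x hxm), hts x hxm⟩
      · obtain ⟨w, hw, hwx⟩ := intermediate_value_uIcc (a := d) (b := t) hf.continuousOn
          (mem_uIcc.2 (Or.inl ⟨by rwa [hd], hxt⟩))
        rw [uIcc_of_le ht.1] at hw
        refine ⟨?_, (hR x hx hxz).trans hxt⟩
        rw [← hwx]
        exact hno w ⟨hw.1, hw.2.trans ht.2⟩
    have hall : ∀ j, f^[j] a ∈ P ∧ d < f^[j] a ∧ f^[j] a ≤ f t := by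
      intro j
      induction j with
      | zero => exact ⟨ha, hda, haz.le.trans hzt⟩
      | succ j ih =>
        rw [iterate_succ_apply']
        exact ⟨hP ih.1, hinv _ ih.1 ih.2.1 ih.2.2⟩
    obtain ⟨j, hj⟩ := htr a ha c hc
    have := (hall j).2.1
    rw [hj] at this
    exact (this.trans_le hdm.1).false
  have hdz : d < z := hda.trans haz
  have hve : v < e := lt_of_le_of_ne hv.2 fun h => by
    rw [h, he, hz] at hvd; exact (hdz.trans_le hvd).false
  have hdv : d < v := lt_of_le_of_ne hv.1 fun h => by
    rw [← h, hd, hz] at hvd; exact (hdz.trans_le hvd).false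
  have hsub : ∀ x, d ≤ x → x ≤ z → x ∈ uIcc z (f (f v)) := fun x h1 h2 =>
    mem_uIcc.2 (Or.inr ⟨hvd.trans h1, h2⟩)
  obtain ⟨y, hy, hyj⟩ := exists_iterate_eq_of_chain (hf.iterate 2)
    (fun j => if j = 0 ∨ j = k then d else v) (fun j => if j = 0 then v else e) k
    (by
      intro j hj
      have hu : uIcc (f^[2] (if j = 0 ∨ j = k then d else v)) (f^[2] (if j = 0 then v else e)) =
          uIcc z (f (f v)) := by
        rcases Nat.eq_zero_or_pos j with rfl | hj0
        · simp [hd, hz]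
        · simp [hj0.ne', hj.ne, he, hz, uIcc_comm]
      rw [hu, if_neg (Nat.succ_ne_zero j)]
      refine ⟨?_, hsub _ hde hem.2⟩
      have hd' := hsub d le_rfl hdz.le
      have hv' := hsub v hdv.le (hve.le.trans hem.2)
      split_ifs <;> assumption)
    (by simp [hk.ne']) (by simp [hk.ne', uIcc_of_le hde, hdv.le, hve.le])
  simp only [← iterate_mul] at hy hyj
  have hmem : ∀ j ≤ k, f^[2 * j] y ∈ Icc d e := by
    intro j hj
    have := hyj j hj
    rw [← uIcc_of_le hde]
    refine uIcc_subset_uIcc ?_ ?_ this <;> rw [uIcc_of_le hde] <;> split_ifs <;>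
      simp [hde, hdv.le, hve.le]
  have hyv : y ∈ Icc d v := by simpa [uIcc_of_le hdv.le] using hyj 0 hk.le
  have hyz : y < z := hyv.2.trans_lt (hve.trans_le hem.2)
  refine ⟨y, minimalPeriod_eq_of_forall_ne (by omega) hy fun l hl1 hl2 hl => ?_⟩
  obtain ⟨j, rfl | rfl⟩ := Nat.even_or_odd' l
  · have h1 := hyj j (by omega)
    rw [hl, if_neg (by omega), if_neg (by omega), uIcc_of_le hve.le] at h1
    obtain rfl : y = v := le_antisymm hyv.2 h1.1
    have h2 := hmem 1 (by omega)
    have h3 : f (f y) = d := le_antisymm hvd h2.1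
    have h4 := hyj 1 (by omega)
    simp only [mul_one, iterate_succ_apply, iterate_zero, id, h3] at h4
    rw [if_neg (by omega), if_neg (by omega), uIcc_of_le hve.le] at h4
    exact (hdv.trans_le h4.1).false
  · have h1 := hge _ (hmem j (by omega))
    rw [← iterate_succ_apply' f, hl] at h1
    exact (hyz.trans_le h1).false

theorem exists_minimalPeriod_eq_two {f : ℝ → ℝ} (hf : Continuous f) {p c : ℝ} (hpc : p ≤ c)
    (hp : p ≤ f (f p)) (hc : f (f c) < c) (hfc : c < f c) : ∃ y, minimalPeriod f y = 2 := by
  have key : ∀ w, w ≤ c → w ≤ f (f w) → (∀ y ∈ Icc w c, f y ≠ y) →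
      ∃ y, minimalPeriod f y = 2 := by
    intro w hwc hw hne
    obtain ⟨y, hy, hy0⟩ := intermediate_value_Icc' (f := fun x => f (f x) - x) hwc
      ((hf.comp hf).sub continuous_id).continuousOn (⟨sub_nonpos.2 hc.le, sub_nonneg.2 hw⟩)
    refine ⟨y, minimalPeriod_eq_of_forall_ne two_pos (sub_eq_zero.1 hy0) fun k hk1 hk2 => ?_⟩
    obtain rfl : k = 1 := by omega
    exact hne y hy
  by_cases h : ∀ y ∈ Icc p c, f y ≠ y
  · exact key p hpc hp h
  · push Not at h
    obtain ⟨q, ⟨hqm, hq⟩, hqmax⟩ := (isCompact_Icc.inter_right (isClosed_eq hf continuous_id) :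
      IsCompact (Icc p c ∩ {x | f x = id x})).exists_isGreatest h
    simp only [mem_ofPred_eq, id] at hq
    obtain ⟨w, hw, hwc⟩ := intermediate_value_Icc hqm.2 hf.continuousOn
      (⟨hq.le.trans hqm.2, hfc.le⟩ : c ∈ Icc (f q) (f c))
    refine key w hw.2 (by rw [hwc]; exact hw.2.trans hfc.le) fun y hy hfy => ?_
    have h1 : y ≤ q := hqmax ⟨⟨hqm.1.trans (hw.1.trans hy.1), hy.2⟩, hfy⟩
    have h2 : w = q := le_antisymm (hy.1.trans h1) hw.1
    rw [h2, hq] at hwc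
    rw [← hwc, hq] at hfc
    exact hfc.false

/-- A periodic orbit with at least two points is split by a fixed point `z` lying between two
consecutive points `a` and `b` of the orbit, which move across `z`. -/
theorem exists_orbit_split {f : ℝ → ℝ} (hf : Continuous f) {x : ℝ}
    (hx : 2 ≤ minimalPeriod f x) :
    ∃ (P : Set ℝ) (a b z : ℝ), P.Finite ∧ MapsTo f P P ∧
      (∀ u ∈ P, ∀ v ∈ P, ∃ j, f^[j] u = v) ∧
      (∀ u ∈ P, minimalPeriod f u = minimalPeriod f x) ∧ a ∈ P ∧ b ∈ P ∧ a < z ∧ z < b ∧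
      f z = z ∧ (∀ u ∈ P, u ≤ a ∨ b ≤ u) ∧ b ≤ f a ∧ f b ≤ a ∧ ∀ u ∈ P, b ≤ u → f u < u := by
  set m := minimalPeriod f x with hm
  have hxp : x ∈ periodicPts f := minimalPeriod_pos_iff_mem_periodicPts.1 (by omega)
  set P : Set ℝ := range fun j => f^[j] x with hPdef
  have hfin : P.Finite := by
    refine ((Set.finite_lt_nat m).image fun j => f^[j] x).subset ?_
    rintro _ ⟨j, rfl⟩
    exact ⟨j % m, Nat.mod_lt _ (by omega), iterate_mod_minimalPeriod_eq⟩
  have hP : MapsTo f P P := by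
    rintro _ ⟨j, rfl⟩
    exact ⟨j + 1, iterate_succ_apply' f j x⟩
  have htr : ∀ u ∈ P, ∀ v ∈ P, ∃ j, f^[j] u = v := by
    rintro _ ⟨i, rfl⟩ _ ⟨j, rfl⟩
    have h1 : i ≤ m * i := Nat.le_mul_of_pos_left i (by omega)
    refine ⟨j + (m * i - i), ?_⟩
    simp only
    rw [← iterate_add_apply, add_assoc, Nat.sub_add_cancel h1, iterate_add_apply,
      ((isPeriodicPt_minimalPeriod f x).mul_const i).eq]
  have hper : ∀ u ∈ P, minimalPeriod f u = m := by
    rintro _ ⟨j, rfl⟩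
    exact minimalPeriod_apply_iterate hxp j
  have hne : ∀ u ∈ P, f u ≠ u := fun u hu h => by
    have := hper u hu
    rw [minimalPeriod_eq_one_iff_isFixedPt.2 h] at this
    omega
  obtain ⟨p, hp, hpmin⟩ := hfin.exists_minimal ⟨x, 0, rfl⟩
  have hpmin' : ∀ u ∈ P, p ≤ u := fun u hu => (le_total p u).elim id (hpmin hu)
  obtain ⟨a, ⟨haP, haf⟩, hamax⟩ := (hfin.subset (sep_subset P fun u => u < f u)).exists_maximal
    ⟨p, hp, lt_of_le_of_ne (hpmin' _ (hP hp)) (hne p hp).symm⟩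
  obtain ⟨b, ⟨hbP, hab⟩, hbmin⟩ := (hfin.subset (sep_subset P fun u => a < u)).exists_minimal
    ⟨f a, hP haP, haf⟩
  have hR : ∀ u ∈ P, b ≤ u → f u < u := by
    intro u hu hbu
    refine lt_of_le_of_ne (not_lt.1 fun h => ?_) (hne u hu)
    exact ((hab.trans_le hbu).trans_le (hamax ⟨hu, h⟩ (hab.trans_le hbu).le)).false
  have hsep : ∀ u ∈ P, u ≤ a ∨ b ≤ u := fun u hu => by
    rcases le_or_gt u a with h | h
    · exact Or.inl h
    · exact Or.inr ((le_total b u).elim id (hbmin ⟨hu, h⟩))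
  have hfa : b ≤ f a := (hsep _ (hP haP)).resolve_left (not_le.2 haf)
  have hbf := hR b hbP le_rfl
  have hfb : f b ≤ a := (hsep _ (hP hbP)).resolve_right (not_le.2 hbf)
  obtain ⟨z, hz, hz0⟩ := intermediate_value_Icc' (f := fun x => f x - x) hab.le
      (hf.sub continuous_id).continuousOn (⟨sub_nonpos.2 hbf.le, sub_nonneg.2 haf.le⟩)
  have hz1 : f z = z := sub_eq_zero.1 hz0
  refine ⟨P, a, b, z, hfin, hP, htr, hper, haP, hbP, lt_of_le_of_ne hz.1 ?_,
    lt_of_le_of_ne hz.2 ?_, hz1, hsep, hfa, hfb, hR⟩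
  · rintro rfl; exact hne _ haP hz1
  · rintro rfl; exact hne _ hbP hz1

/-- All even periods are forced as soon as some point of the orbit stays on its side of the fixed
point `z`. -/
theorem exists_minimalPeriod_eq_two_mul_of_sameSide {f : ℝ → ℝ} (hf : Continuous f) {P : Set ℝ}
    (hP : MapsTo f P P) (htr : ∀ x ∈ P, ∀ y ∈ P, ∃ j, f^[j] x = y) {a b z : ℝ} (ha : a ∈ P)
    (hb : b ∈ P) (haz : a < z) (hzb : z < b) (hz : f z = z) (hsep : ∀ u ∈ P, u ≤ a ∨ b ≤ u)
    (hfa : b ≤ f a) (hfb : f b ≤ a) (hR : ∀ u ∈ P, b ≤ u → f u < u)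
    (h : ∃ c ∈ P, c ≤ a ∧ f c ≤ a ∨ b ≤ c ∧ b ≤ f c) {k : ℕ} (hk : 0 < k) :
    ∃ y, minimalPeriod f y = 2 * k := by
  by_cases hl : ∃ c ∈ P, c ≤ a ∧ f c ≤ a
  · obtain ⟨c, hc, hca, hfc⟩ := hl
    refine exists_minimalPeriod_eq_two_mul_of_le hf hP htr hz ha haz (hzb.trans_le hfa)
      (fun x hx => (hsep x hx).imp_right hzb.le.trans)
      (fun x hx hzx => (hR x hx ((hsep x hx).resolve_left fun h => ?_)).le) hc hca
      (hfc.trans haz.le) hk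
    exact (haz.trans_le (hzx.trans h)).false
  · push Not at hl
    obtain ⟨c, hc, h | ⟨hbc, hfc⟩⟩ := h
    · exact absurd h.2 (not_le.2 (hl c hc h.1))
    have hs : Semiconj (fun t : ℝ => -t) f (fun t => -f (-t)) := fun t => by simp
    obtain ⟨y, hy⟩ := exists_minimalPeriod_eq_two_mul_of_le (f := fun t => -f (-t))
      (P := {x | -x ∈ P}) (a := -b) (c := -c) (z := -z) (by fun_prop)
      (fun x hx => by simpa using hP hx)
      (fun x hx y hy => by
        obtain ⟨j, hj⟩ := htr _ hx _ hy
        refine ⟨j, ?_⟩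
        have := (hs.iterate_right j) (-x)
        simp only [neg_neg, hj] at this
        exact this.symm)
      (by simpa using hz) (by simpa using hb) (by simpa using hzb)
      (by simpa using hfb.trans_lt haz)
      (fun x hx => by
        rcases hsep _ hx with h | h
        · right; linarith
        · left; linarith)
      (fun x hx hzx => by
        have h1 : -x ≤ a := (hsep _ hx).resolve_right fun h => by linarith
        have h2 := (hsep _ (hP hx)).resolve_left (not_le.2 (hl _ hx h1))
        linarith)
      (by simpa using hc) (by simpa using hbc) (by simpa using hzb.le.trans hfc) hk
    exact ⟨-y, by rw [← minimalPeriod_neg_conj, hy]⟩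

theorem exists_iterate_sameSide_of_odd {f : ℝ → ℝ} {a b : ℝ} (hab : a < b)
    (hsep : ∀ j, f^[j] a ≤ a ∨ b ≤ f^[j] a) {m : ℕ} (hm : Odd m) (hma : f^[m] a = a) :
    ∃ i < m, (∀ j ≤ i, (Even j → f^[j] a ≤ a) ∧ (Odd j → b ≤ f^[j] a)) ∧
      (Even i → f^[i + 1] a ≤ a) ∧ (Odd i → b ≤ f^[i + 1] a) := by
  classical
  have hex : ∃ j, ¬ ((Even j → f^[j] a ≤ a) ∧ (Odd j → b ≤ f^[j] a)) :=
    ⟨m, fun h => by have := h.2 hm; rw [hma] at this; exact (hab.trans_le this).false⟩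
  have hle : Nat.find hex ≤ m :=
    Nat.find_min' hex fun h => by have := h.2 hm; rw [hma] at this; exact (hab.trans_le this).false
  have hspec := Nat.find_spec hex
  have hmin := fun j => Nat.find_min hex (m := j)
  generalize Nat.find hex = i at hle hspec hmin
  rcases i with _ | i
  · simp at hspec
  · refine ⟨i, by omega, fun j hj => not_not.1 (hmin j (by omega)), fun he => ?_, fun ho => ?_⟩
    · by_contra hcon
      refine hspec ⟨fun h => absurd he ?_, fun _ => (hsep _).resolve_left hcon⟩
      simpa [Nat.even_add_one] using h
    · by_contra hcon
      refine hspec ⟨fun _ => (hsep _).resolve_right hcon, fun h => absurd ho ?_⟩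
      simpa [Nat.odd_add_one] using h

theorem exists_minimalPeriod_eq_of_odd_le {f : ℝ → ℝ} (hf : Continuous f) {a b z : ℝ}
    (haz : a < z) (hzb : z < b) (hz : f z = z) (hsep : ∀ j, f^[j] a ≤ a ∨ b ≤ f^[j] a)
    (hfa : b ≤ f a) (hfb : f b ≤ a) {m n : ℕ} (hm : Odd m) (hma : f^[m] a = a)
    (hn : Odd n) (hmn : m ≤ n) (hn1 : 1 < n) : ∃ y, minimalPeriod f y = n := by
  obtain ⟨i, him, halt, hie, hio⟩ :=
    exists_iterate_sameSide_of_odd (haz.trans hzb) hsep hm hma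
  obtain ⟨N, rfl⟩ : ∃ N, n = N + 1 := ⟨n - 1, by omega⟩
  have hN : Even N := by simpa [Nat.odd_add_one] using hn
  obtain ⟨t, rfl⟩ : ∃ t, N = t + i := ⟨N - i, by omega⟩
  -- alternate `t` times between `a` and `b`, then follow the orbit of `a` up to time `i`
  set u : ℕ → ℝ := fun j => if j < t then if Even (t + j) then a else b else f^[j - t] a with hu
  have hside : ∀ j ≤ t + i, (Even (t + j) → u j ≤ a) ∧ (Odd (t + j) → b ≤ u j) := by
    intro j hj
    simp only [hu]
    split_ifs with h1 h2
    · exact ⟨fun _ => le_rfl, fun h => absurd h2 (Nat.not_even_iff_odd.2 h)⟩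
    · exact ⟨fun h => absurd h h2, fun _ => le_rfl⟩
    · have h3 := halt (j - t) (by omega)
      rw [Nat.even_sub (by omega), Nat.odd_sub (by omega)] at h3
      rw [Nat.even_add, Nat.odd_add']
      exact ⟨fun h => h3.1 h.symm, fun h => h3.2 h⟩
  have hstep : ∀ j < t + i, u (j + 1) ∈ uIcc z (f (u j)) := by
    intro j hj
    rcases Nat.lt_or_ge j t with hjt | hjt
    · have h1 : u (j + 1) = if Even (t + (j + 1)) then a else b := by
        simp only [hu]
        split_ifs with h2 h3 h3
        · rfl
        · rfl
        · obtain rfl : j + 1 = t := by omega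
          simp
        · obtain rfl : j + 1 = t := by omega
          simp at h3
      have h2 : u j = if Even (t + j) then a else b := by simp only [hu, if_pos hjt]
      rw [h1, h2, ← add_assoc]
      have hpar : Even (t + j + 1) ↔ ¬ Even (t + j) := Nat.even_add_one
      by_cases he : Even (t + j)
      · rw [if_pos he, if_neg fun h => hpar.1 h he]
        exact mem_uIcc.2 (Or.inl ⟨hzb.le, hfa⟩)
      · rw [if_neg he, if_pos (hpar.2 he)]
        exact mem_uIcc.2 (Or.inr ⟨hfb, haz.le⟩)
    · have h1 : u (j + 1) = f (u j) := by
        simp only [hu]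
        rw [if_neg (by omega), if_neg (by omega), Nat.sub_add_comm hjt, iterate_succ_apply']
      rw [h1]
      exact right_mem_uIcc
  have hui : u (t + i) = f^[i] a := by simp [hu]
  have hfui : f (u (t + i)) = f^[i + 1] a := by rw [hui, iterate_succ_apply']
  have hu0 := hside 0 (by omega)
  have hu0' : u 0 = a ∨ u 0 = b := by
    rcases Nat.eq_zero_or_pos t with rfl | ht
    · simp [hu]
    · simp only [hu, if_pos ht]
      split_ifs <;> simp
  rcases Nat.even_or_odd i with he | ho
  · have ht : Even t := by rw [Nat.even_add] at hN; tauto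
    have hc : u (t + i) ≤ a := hui ▸ (halt i le_rfl).1 he
    have hfc : f (u (t + i)) ≤ a := hfui ▸ hie he
    obtain ⟨d, hdm, hd⟩ := intermediate_value_Icc hc hf.continuousOn
      (⟨hfc.trans haz.le, hzb.le.trans hfa⟩ : z ∈ Icc (f (u (t + i))) (f a))
    have h0 : u 0 = a := hu0'.resolve_right fun h => by
      have := hu0.1 (by simpa using ht)
      rw [h] at this
      linarith
    refine exists_minimalPeriod_eq_of_alternating hf hz u hN (by omega)
      (fun j hj h => ((hside j hj).1 (ht.add h)).trans_lt haz)
      (fun j hj h => hzb.trans_le ((hside j hj).2 (ht.add_odd h))) hstep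
      (lt_of_le_of_ne hdm.1 ?_) (hdm.2.trans_lt haz) hd
      (mem_uIcc.2 (Or.inr ⟨h0 ▸ hfc, h0 ▸ haz.le⟩))
    intro h
    rw [h, hd] at hfc
    linarith
  · have ht : Odd t := by rw [Nat.even_add', iff_true_right ho] at hN; exact hN
    have hc : b ≤ u (t + i) := hui ▸ (halt i le_rfl).2 ho
    have hfc : b ≤ f (u (t + i)) := hfui ▸ hio ho
    obtain ⟨d, hdm, hd⟩ := intermediate_value_Icc hc hf.continuousOn
      (⟨hfb.trans haz.le, hzb.le.trans hfc⟩ : z ∈ Icc (f b) (f (u (t + i))))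
    have h0 : u 0 = b := hu0'.resolve_left fun h => by
      have := hu0.2 (by simpa using ht)
      rw [h] at this
      linarith
    have hdc : d < u (t + i) := lt_of_le_of_ne hdm.2 fun h => by
      rw [← h, hd] at hfc
      linarith
    obtain ⟨y, hy⟩ := exists_minimalPeriod_eq_of_alternating (f := fun x => -f (-x)) (z := -z)
      (d := -d) (by fun_prop) (by simpa using hz) (fun j => -u j) hN (by omega)
      (fun j hj h => neg_lt_neg (hzb.trans_le ((hside j hj).2 (ht.add_even h))))
      (fun j hj h => neg_lt_neg (((hside j hj).1 (ht.add_odd h)).trans_lt haz))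
      (fun j hj => by
        have := hstep j hj
        simp only [mem_uIcc, neg_neg, neg_le_neg_iff] at this ⊢
        tauto)
      (neg_lt_neg hdc) (neg_lt_neg (hzb.trans_le hdm.1)) (by simpa using hd)
      (by
        simp only [mem_uIcc, neg_neg, neg_le_neg_iff, h0]
        exact Or.inr ⟨hfc, hzb.le⟩)
    exact ⟨-y, by rw [← minimalPeriod_neg_conj, hy]⟩

theorem exists_minimalPeriod_eq_two_mul_of_odd {f : ℝ → ℝ} (hf : Continuous f) {x : ℝ}
    (hx : 1 < minimalPeriod f x) (hodd : Odd (minimalPeriod f x)) {k : ℕ} (hk : 0 < k) :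
    ∃ y, minimalPeriod f y = 2 * k := by
  obtain ⟨P, a, b, z, -, hP, htr, hper, ha, hb, haz, hzb, hz, hsep, hfa, hfb, hR⟩ :=
    exists_orbit_split hf hx
  have hmem : ∀ j, f^[j] a ∈ P := fun j => hP.iterate j ha
  obtain ⟨i, -, halt, hie, hio⟩ := exists_iterate_sameSide_of_odd (haz.trans hzb)
    (fun j => hsep _ (hmem j)) hodd (by rw [← hper a ha]; exact iterate_minimalPeriod)
  refine exists_minimalPeriod_eq_two_mul_of_sameSide hf hP htr ha hb haz hzb hz hsep hfa hfb hR
    ⟨f^[i] a, hmem i, ?_⟩ hk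
  rw [← iterate_succ_apply' f]
  rcases Nat.even_or_odd i with h | h
  · exact Or.inl ⟨(halt i le_rfl).1 h, hie h⟩
  · exact Or.inr ⟨(halt i le_rfl).2 h, hio h⟩

theorem exists_minimalPeriod_eq_of_odd_of_odd {f : ℝ → ℝ} (hf : Continuous f) {x : ℝ} {n : ℕ}
    (hx : 1 < minimalPeriod f x) (hodd : Odd (minimalPeriod f x)) (hn : Odd n)
    (hxn : minimalPeriod f x ≤ n) : ∃ y, minimalPeriod f y = n := by
  obtain ⟨P, a, b, z, -, hP, htr, hper, ha, hb, haz, hzb, hz, hsep, hfa, hfb, hR⟩ :=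
    exists_orbit_split hf hx
  exact exists_minimalPeriod_eq_of_odd_le hf haz hzb hz (fun j => hsep _ (hP.iterate j ha)) hfa
    hfb hodd (by rw [← hper a ha]; exact iterate_minimalPeriod) hn hxn (hx.trans_le hxn)

theorem exists_minimalPeriod_eq_two_of_two_lt {f : ℝ → ℝ} (hf : Continuous f) {x : ℝ}
    (hx : 2 < minimalPeriod f x) : ∃ y, minimalPeriod f y = 2 := by
  obtain ⟨P, a, b, z, hfin, hP, htr, hper, ha, hb, haz, hzb, hz, hsep, hfa, hfb, hR⟩ :=
    exists_orbit_split hf hx.le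
  by_cases h : ∃ c ∈ P, c ≤ a ∧ f c ≤ a ∨ b ≤ c ∧ b ≤ f c
  · exact exists_minimalPeriod_eq_two_mul_of_sameSide hf hP htr ha hb haz hzb hz hsep hfa hfb hR h
      one_pos
  push Not at h
  -- every point changes sides: go two steps back from the least point of the orbit
  obtain ⟨p, hp, hpmin⟩ := hfin.exists_minimal ⟨a, ha⟩
  have hpmin' : ∀ u ∈ P, p ≤ u := fun u hu => (le_total p u).elim id (hpmin hu)
  obtain ⟨j, hj⟩ := htr (f (f p)) (hP (hP hp)) p hp
  have hc : f^[j] p ∈ P := hP.iterate j hp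
  have hffc : f (f (f^[j] p)) = p := by
    rw [← iterate_succ_apply' f, ← iterate_succ_apply' f, iterate_succ_apply,
      iterate_succ_apply, hj]
  generalize f^[j] p = c at hc hffc
  have hpc : p < c := lt_of_le_of_ne (hpmin' c hc) fun hpc => by
    rw [← hpc] at hffc
    have : IsPeriodicPt f 2 p := hffc
    have := this.minimalPeriod_le two_pos
    rw [hper p hp] at this
    omega
  have hca : c ≤ a := by
    by_contra hca
    have h1 := (hsep c hc).resolve_left hca
    have h2 := (hsep _ (hP hc)).resolve_right (not_le.2 ((h c hc).2 h1))
    have h3 := (h _ (hP hc)).1 h2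
    rw [hffc] at h3
    linarith [hpmin' a ha]
  exact exists_minimalPeriod_eq_two hf hpc.le (hpmin' _ (hP (hP hp))) (hffc ▸ hpc)
    (hca.trans_lt ((h c hc).1 hca))

theorem exists_minimalPeriod_eq_of_iterate_two_pow {α : Type*} {f : α → α} {e k : ℕ}
    (h : ∃ y, minimalPeriod f^[2 ^ e] y = k) :
    ∃ i ≤ e, (Even k → i = e) ∧ ∃ y, minimalPeriod f y = 2 ^ i * k := by
  obtain ⟨y, hy⟩ := h
  rw [minimalPeriod_iterate_eq_div_gcd (by positivity)] at hy
  obtain ⟨i, hi, hg⟩ := (Nat.dvd_prime_pow Nat.prime_two).1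
    (Nat.gcd_dvd_right (minimalPeriod f y) (2 ^ e))
  have hL : minimalPeriod f y = 2 ^ i * k := by
    rw [← hy, ← hg, Nat.mul_div_cancel' (Nat.gcd_dvd_left _ _)]
  refine ⟨i, hi, fun hev => ?_, y, hL⟩
  by_contra hne
  have h1 : 2 ^ (i + 1) ∣ 2 ^ i := by
    rw [← hg]
    refine Nat.dvd_gcd ?_ (pow_dvd_pow 2 (by omega))
    rw [hL, pow_succ]
    exact mul_dvd_mul_left _ hev.two_dvd
  exact absurd ((Nat.pow_dvd_pow_iff_le_right (by norm_num)).1 h1) (by omega)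

theorem minimalPeriod_iterate_two_pow {α : Type*} {f : α → α} {x : α} {e k : ℕ}
    (h : minimalPeriod f x = 2 ^ e * k) : minimalPeriod f^[2 ^ e] x = k := by
  rw [minimalPeriod_iterate_eq_div_gcd (by positivity), h, Nat.gcd_mul_right_left,
    Nat.mul_div_cancel_left _ (by positivity)]

/-- Odd periods greater than one force all even multiples of their power of two. -/
theorem exists_minimalPeriod_eq_two_pow_succ_mul {f : ℝ → ℝ} (hf : Continuous f) {x : ℝ}
    {e q k : ℕ} (hq : Odd q) (hq1 : 1 < q) (hx : minimalPeriod f x = 2 ^ e * q) (hk : 0 < k) :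
    ∃ y, minimalPeriod f y = 2 ^ (e + 1) * k := by
  have h1 := minimalPeriod_iterate_two_pow hx
  obtain ⟨i, -, hi, y, hy⟩ := exists_minimalPeriod_eq_of_iterate_two_pow
    (exists_minimalPeriod_eq_two_mul_of_odd (hf.iterate _) (by rwa [h1]) (by rwa [h1]) hk)
  rw [hi (even_two_mul k)] at hy
  exact ⟨y, by rw [hy]; ring⟩

theorem exists_minimalPeriod_eq_of_sharkovskiiGt {f : ℝ → ℝ} (hf : Continuous f) {x : ℝ}
    {n m : ℕ} (hx : minimalPeriod f x = n) (hnm : SharkovskiiGt n m) :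
    ∃ y, minimalPeriod f y = m := by
  obtain ⟨e, q, e', q', hq, hq', rfl, rfl, h⟩ := hnm
  have hlow : e' ≤ e → 1 < 2 ^ (e - e') * q → ∃ y, minimalPeriod f y = 2 ^ e' := by
    intro hle hlt
    rcases e' with _ | e'
    · obtain ⟨P, a, b, z, -, -, -, -, -, -, -, -, hz, -⟩ := exists_orbit_split hf
        (x := x) (by simpa [hx, Nat.succ_le_iff] using hlt)
      exact ⟨z, minimalPeriod_eq_one_iff_isFixedPt.2 hz⟩
    · have h1 : minimalPeriod f^[2 ^ e'] x = 2 * (2 ^ (e - (e' + 1)) * q) := by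
        apply minimalPeriod_iterate_two_pow
        rw [hx, ← mul_assoc, ← mul_assoc, ← pow_succ, ← pow_add, Nat.add_sub_cancel' hle]
      obtain ⟨i, -, hi, y, hy⟩ := exists_minimalPeriod_eq_of_iterate_two_pow
        (exists_minimalPeriod_eq_two_of_two_lt (hf.iterate (2 ^ e')) (x := x)
          (by rw [h1]; omega))
      rw [hi even_two] at hy
      exact ⟨y, by rw [hy, pow_succ]⟩
  have hhigh : 1 < q → e < e' → ∃ y, minimalPeriod f y = 2 ^ e' * q' := by
    intro hq1 hlt
    obtain ⟨r, rfl⟩ : ∃ r, e' = e + 1 + r := ⟨e' - (e + 1), by omega⟩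
    rw [pow_add, mul_assoc]
    exact exists_minimalPeriod_eq_two_pow_succ_mul hf hq hq1 hx
      (Nat.mul_pos (by positivity) hq'.pos)
  rcases h with ⟨hq1, -, hlt⟩ | ⟨hq1, hq1', rfl, hqq⟩ | ⟨hq1, rfl⟩ | ⟨rfl, rfl, hlt⟩
  · exact hhigh hq1 hlt
  · have h1 := minimalPeriod_iterate_two_pow hx
    obtain ⟨i, hie, -, y, hy⟩ := exists_minimalPeriod_eq_of_iterate_two_pow
      (exists_minimalPeriod_eq_of_odd_of_odd (hf.iterate (2 ^ e)) (x := x) (by rwa [h1])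
        (by rwa [h1]) hq' (by rw [h1]; exact hqq.le))
    rcases hie.eq_or_lt with rfl | hlt
    · exact ⟨y, hy⟩
    · obtain ⟨r, rfl⟩ : ∃ r, e = i + 1 + r := ⟨e - (i + 1), by omega⟩
      rw [pow_add, mul_assoc]
      exact exists_minimalPeriod_eq_two_pow_succ_mul hf hq' hq1' hy
        (Nat.mul_pos (by positivity) hq'.pos)
  · rcases Nat.lt_or_ge e e' with hlt | hle
    · exact hhigh hq1 hlt
    · rw [mul_one]
      exact hlow hle (hq1.trans_le (Nat.le_mul_of_pos_left q (by positivity)))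
  · rw [mul_one]
    refine hlow hlt.le ?_
    rw [mul_one]
    exact Nat.one_lt_two_pow (by omega)

end

/-- Sharkovskii's theorem: if a continuous self-map of `[0,1]` has a periodic point of
least period `n`, then it has a periodic point of least period `m` for every `m` with
`n ≻ m` in the Sharkovskii order. -/
theorem sharkovskii (f : Set.Icc (0 : ℝ) 1 → Set.Icc (0 : ℝ) 1) (hf : Continuous f)
    (n : ℕ) (hn : 0 < n) (x : Set.Icc (0 : ℝ) 1)
    (hx : f^[n] x = x) (hxleast : ∀ k, 1 ≤ k → k < n → f^[k] x ≠ x)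
    (m : ℕ) (hm : 0 < m) (hnm : SharkovskiiGt n m) :
    ∃ y : Set.Icc (0 : ℝ) 1, f^[m] y = y ∧ ∀ k, 1 ≤ k → k < m → f^[k] y ≠ y := by
  set F : ℝ → ℝ := fun t => f (Set.projIcc 0 1 zero_le_one t) with hF
  have hs : Function.Semiconj (Subtype.val : Set.Icc (0 : ℝ) 1 → ℝ) f F := fun t => by simp [hF]
  have hiter : ∀ k (t : Set.Icc (0 : ℝ) 1), F^[k] t = f^[k] t := fun k t =>
    ((hs.iterate_right k) t).symm
  have hxF : Function.minimalPeriod F x = n :=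
    Function.minimalPeriod_eq_of_forall_ne hn (by rw [hiter, hx]) fun k h1 h2 h => by
      rw [hiter] at h
      exact hxleast k h1 h2 (Subtype.ext h)
  obtain ⟨y, hy⟩ := exists_minimalPeriod_eq_of_sharkovskiiGt (by fun_prop) hxF hnm
  have hyF : F^[m] y = y := by rw [← hy]; exact Function.iterate_minimalPeriod
  obtain ⟨w, rfl⟩ : ∃ w : Set.Icc (0 : ℝ) 1, (w : ℝ) = y := by
    obtain ⟨k, rfl⟩ : ∃ k, m = k + 1 := ⟨m - 1, by omega⟩
    rw [Function.iterate_succ_apply'] at hyF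
    exact ⟨_, hyF⟩
  refine ⟨w, Subtype.ext (by rw [← hiter, hyF]), fun k h1 h2 h => ?_⟩
  have hp : Function.IsPeriodicPt F k w := by
    rw [Function.IsPeriodicPt, Function.IsFixedPt, hiter, h]
  have := hp.minimalPeriod_le h1
  omega
end

section
/- Let R be a commutative ring, let d ≥ 1 and k ≥ 1, and let A₁, …, A_k be d×d matrices over R. Let A be the (kd)×(kd) block matrix whose (i, i+1)-th d×d block equals A_{i+1} for 1 ≤ i ≤ k−1, whose (k, 1)-th d×d block equals A₁, and all of whose other d×d blocks are zero. Then det(I − A) = det(I − A₁A₂⋯A_k), where I denotes the identity matrix of the appropriate size. -/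
namespace CyclicBlock

open Matrix

variable {R ι : Type*} [CommRing R] {k : ℕ}

/-- The block matrix whose `(i, i + 1)`-th block is `A (i + 1)`, all other blocks being zero. -/
def superdiag (A : Fin k → Matrix ι ι R) : Matrix (Fin k × ι) (Fin k × ι) R :=
  fun p q => if (q.1 : ℕ) = p.1 + 1 then A q.1 p.2 q.2 else 0

/-- The block column whose `i`-th block is the product of the `A j` with `j > i`. -/
def tailProd [Fintype ι] [DecidableEq ι] (A : Fin k → Matrix ι ι R) : Matrix (Fin k × ι) ι R :=
  fun p t => ((List.ofFn A).drop (p.1 + 1)).prod p.2 t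

/-- The block row whose `0`-th block is `A 0`, all other blocks being zero. -/
def headRow (A : Fin k → Matrix ι ι R) : Matrix ι (Fin k × ι) R :=
  fun r q => if (q.1 : ℕ) = 0 then A q.1 r q.2 else 0

/-- The block column whose last block is the identity, all other blocks being zero. -/
def lastCol (R ι : Type*) [CommRing R] [DecidableEq ι] (k : ℕ) : Matrix (Fin k × ι) ι R :=
  fun p t => if (p.1 : ℕ) + 1 = k then (1 : Matrix ι ι R) p.2 t else 0

variable [Fintype ι] [DecidableEq ι]

theorem det_one_sub_superdiag (A : Fin k → Matrix ι ι R) : (1 - superdiag A).det = 1 := by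
  have h : (1 - superdiag A).BlockTriangular Prod.fst := by
    rintro ⟨i, r⟩ ⟨j, s⟩ hij
    have hij : (j : ℕ) < i := hij
    have hne : i ≠ j := fun h => by simp [h] at hij
    have hsucc : ¬ (j : ℕ) = i + 1 := by omega
    simp [superdiag, hne, hsucc]
  rw [h.det_fintype]
  refine Finset.prod_eq_one fun i _ => ?_
  have hblock : (1 - superdiag A).toSquareBlock Prod.fst i = 1 := by
    ext ⟨⟨a, r⟩, ha⟩ ⟨⟨b, s⟩, hb⟩
    obtain rfl : a = i := ha
    obtain rfl : b = a := hb
    simp [toSquareBlock_def, superdiag, Matrix.one_apply]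
  rw [hblock, det_one]

theorem tailProd_eq_superdiag_mul_add (A : Fin k → Matrix ι ι R) :
    tailProd A = superdiag A * tailProd A + lastCol R ι k := by
  ext ⟨i, r⟩ t
  rw [Matrix.add_apply, Matrix.mul_apply, Fintype.sum_prod_type]
  by_cases hi : (i : ℕ) + 1 < k
  · rw [Finset.sum_eq_single ⟨i + 1, hi⟩]
    · have hdrop := List.drop_eq_getElem_cons (l := List.ofFn A) (i := i + 1) (by simpa using hi)
      simp [tailProd, superdiag, lastCol, hi.ne, hdrop, Matrix.mul_apply]
    · intro j _ hj
      have hj' : ¬ (j : ℕ) = i + 1 := fun h => hj (Fin.ext h)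
      simp [superdiag, hj']
    · simp
  · have hlast : (i : ℕ) + 1 = k := by omega
    have hzero (j : Fin k) : ¬ (j : ℕ) = k := j.isLt.ne
    have hdrop : (List.ofFn A).drop k = [] := by simp
    simp [tailProd, superdiag, lastCol, hlast, hzero, hdrop]

theorem headRow_mul_tailProd (A : Fin k → Matrix ι ι R) (hk : 0 < k) :
    headRow A * tailProd A = (List.ofFn A).prod := by
  ext r t
  rw [Matrix.mul_apply, Fintype.sum_prod_type, Finset.sum_eq_single ⟨0, hk⟩]
  · have hdrop := List.drop_eq_getElem_cons (l := List.ofFn A) (i := 0) (by simpa using hk)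
    rw [List.drop_zero] at hdrop
    rw [hdrop]
    simp [tailProd, headRow, Matrix.mul_apply]
  · intro j _ hj
    have hj' : ¬ (j : ℕ) = 0 := fun h => hj (Fin.ext h)
    simp [headRow, hj']
  · simp

theorem superdiag_add_lastCol_mul_headRow_apply (A : Fin k → Matrix ι ι R)
    (i j : Fin k) (r s : ι) :
    (superdiag A + (lastCol R ι k * headRow A : Matrix (Fin k × ι) (Fin k × ι) R)) (i, r) (j, s) =
      if (j : ℕ) = (i + 1) % k then A j r s else 0 := by
  rw [Matrix.add_apply, Matrix.mul_apply]
  by_cases hi : (i : ℕ) + 1 = k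
  · have hj : ¬ (j : ℕ) = k := j.isLt.ne
    simp [superdiag, lastCol, headRow, hi, hj, Matrix.one_apply]
  · have hmod : ((i : ℕ) + 1) % k = i + 1 := Nat.mod_eq_of_lt (by omega)
    simp [superdiag, lastCol, hi, hmod]

end CyclicBlock

/-- Let `A₁, …, A_k` be `d × d` matrices over a commutative ring `R` and let `A` be the
`(kd) × (kd)` block matrix whose `(i, i+1)`-th block is `A_{i+1}` (for `1 ≤ i ≤ k-1`),
whose `(k, 1)`-th block is `A₁`, and whose other blocks vanish.  Then
`det(I - A) = det(I - A₁A₂⋯A_k)`.  (Here blocks are indexed by `Fin k`, with `A i`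
denoting `A_{i+1}`, so the nonzero blocks are the `(i, j)` ones with
`j ≡ i + 1 (mod k)`, the `(i, j)`-th block being `A j`.) -/
theorem det_one_sub_cyclic_block_matrix {R : Type*} [CommRing R]
    (d k : ℕ) (hd : 1 ≤ d) (hk : 1 ≤ k)
    (A : Fin k → Matrix (Fin d) (Fin d) R)
    (M : Matrix (Fin k × Fin d) (Fin k × Fin d) R)
    (hM : ∀ i j : Fin k, ∀ r s : Fin d,
      M (i, r) (j, s) = if (j : ℕ) = ((i : ℕ) + 1) % k then A j r s else 0) :
    (1 - M).det = (1 - (List.ofFn A).prod).det := by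
  obtain rfl : M = CyclicBlock.superdiag A +
      (CyclicBlock.lastCol R (Fin d) k * CyclicBlock.headRow A :
        Matrix (Fin k × Fin d) (Fin k × Fin d) R) := by
    ext ⟨i, r⟩ ⟨j, s⟩
    rw [hM, CyclicBlock.superdiag_add_lastCol_mul_headRow_apply]
  have hlast : CyclicBlock.lastCol R (Fin d) k =
      (1 - CyclicBlock.superdiag A) * CyclicBlock.tailProd A := by
    rw [Matrix.sub_mul, Matrix.one_mul]
    exact eq_sub_of_add_eq' (CyclicBlock.tailProd_eq_superdiag_mul_add A).symm
  have hfactor : 1 - (CyclicBlock.superdiag A +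
        (CyclicBlock.lastCol R (Fin d) k * CyclicBlock.headRow A :
          Matrix (Fin k × Fin d) (Fin k × Fin d) R)) =
      (1 - CyclicBlock.superdiag A) *
        (1 - CyclicBlock.tailProd A * CyclicBlock.headRow A) := by
    rw [hlast, Matrix.mul_sub, Matrix.mul_one, Matrix.mul_assoc, sub_sub]
  rw [hfactor, Matrix.det_mul, CyclicBlock.det_one_sub_superdiag, one_mul,
    Matrix.det_one_sub_mul_comm, CyclicBlock.headRow_mul_tailProd A hk]
end

section
/- Let R be a commutative ring, t ∈ R, m ≥ 1, let n₁, …, n_m be integers, and let η be an m-cycle in the symmetric group Σ_m (a permutation whose cycle decomposition consists of a single cycle of length m). Let B be the m×m matrix over R with B_{ij} = (−1)^{n_j} if η(j) = i and B_{ij} = 0 otherwise. Then det(I − t·B) = 1 − (−1)^{n₁+⋯+n_m}·t^m. -/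
/-- A permutation that sends each point either to itself or to its image under a transitive
cycle `η` is either the identity or `η`. -/
theorem Equiv.Perm.IsCycleOn.eq_one_or_eq_of_forall_apply {ι : Type*} [Finite ι]
    {η σ : Equiv.Perm ι} (hη : η.IsCycleOn _root_.Set.univ) (hσ : ∀ i, σ i = i ∨ σ i = η i) :
    σ = 1 ∨ σ = η := by
  by_cases h : ∃ i, σ i = i
  · left
    obtain ⟨i, hi⟩ := h
    have step : ∀ j, σ (η j) = η j → σ j = j := fun j hj => by
      rcases hσ j with h | h
      · exact h
      · exact h.trans (σ.injective (h.trans hj.symm)).symm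
    ext j
    obtain ⟨k, hk⟩ := hη.exists_pow_eq' Set.finite_univ (Set.mem_univ j) (Set.mem_univ i)
    have descend : ∀ k : ℕ, σ ((η ^ k) j) = (η ^ k) j → σ j = j := by
      intro k
      induction k with
      | zero => exact id
      | succ k ih =>
        rw [pow_succ', Equiv.Perm.mul_apply]
        exact fun h => ih (step _ h)
    exact descend k (by rw [hk, hi])
  · right
    ext i
    exact (hσ i).resolve_left fun hi => h ⟨i, hi⟩

/-- The determinant of the identity minus a weighted permutation matrix of a transitive cycle. -/
theorem Matrix.det_one_sub_of_isCycleOn {ι R : Type*} [Fintype ι] [DecidableEq ι] [Nonempty ι]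
    [CommRing R] {η : Equiv.Perm ι} (hη : η.IsCycleOn Set.univ) (c : ι → R) :
    (1 - Matrix.of fun i j => if η j = i then c j else 0).det = 1 - ∏ j, c j := by
  rcases subsingleton_or_nontrivial ι with hι | hι
  · obtain ⟨i⟩ := ‹Nonempty ι›
    rw [Matrix.det_eq_elem_of_subsingleton _ i, Fintype.prod_subsingleton _ i]
    simp [Subsingleton.elim (η i) i]
  · have hne : ∀ i, η i ≠ i := fun i => hη.apply_ne Set.nontrivial_univ (Set.mem_univ i)
    have hη1 : (1 : Equiv.Perm ι) ≠ η := by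
      rintro rfl
      exact hne (Classical.arbitrary ι) rfl
    have hcycle : η.IsCycle :=
      Equiv.Perm.isCycle_iff_exists_isCycleOn.2
        ⟨Set.univ, Set.nontrivial_univ, hη, fun _ _ => Set.mem_univ _⟩
    have hsupp : η.support = Finset.univ := by
      ext i
      simp [hne i]
    rw [Matrix.det_apply', ← Finset.sum_subset (Finset.subset_univ {1, η}),
      Finset.sum_pair hη1]
    · have hone : ∏ i, (1 - Matrix.of fun i j => if η j = i then c j else 0 : Matrix ι ι R)
          ((1 : Equiv.Perm ι) i) i = 1 :=
        Finset.prod_eq_one fun i _ => by simp [hne i]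
      have hcyc : ∏ i, (1 - Matrix.of fun i j => if η j = i then c j else 0 : Matrix ι ι R)
          (η i) i = (-1) ^ Fintype.card ι * ∏ i, c i := by
        rw [← Finset.card_univ, ← Finset.prod_neg]
        exact Finset.prod_congr rfl fun i _ => by simp [hne i]
      have hsq : ((-1 : R) ^ Fintype.card ι) * (-1) ^ Fintype.card ι = 1 := by
        rw [← mul_pow]
        simp
      rw [hone, hcyc, hcycle.sign, hsupp, Finset.card_univ]
      push_cast [Equiv.Perm.sign_one]
      linear_combination -(∏ i, c i) * hsq
    · intro σ _ hσ
      have : ¬ ∀ i, σ i = i ∨ σ i = η i := fun h => hσ <| by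
        simpa using hη.eq_one_or_eq_of_forall_apply h
      push Not at this
      obtain ⟨i, hi, hi'⟩ := this
      rw [Finset.prod_eq_zero (Finset.mem_univ i), mul_zero]
      simp [Matrix.one_apply_ne hi, hi'.symm]


/-- Let `η` be an `m`-cycle in `Σ_m` (a single cycle through all of `{1,…,m}`),
`n₁, …, n_m` integers, and `B` the `m × m` matrix over a commutative ring `R` with
`B i j = (-1)^(n j)` if `η j = i` and `B i j = 0` otherwise.  Then
`det(I - t • B) = 1 - (-1)^(n₁ + ⋯ + n_m) * t^m`. -/
theorem det_one_sub_smul_cycle_matrix {R : Type*} [CommRing R] (t : R)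
    (m : ℕ) (hm : 1 ≤ m) (n : Fin m → ℤ) (η : Equiv.Perm (Fin m))
    (hη : η.IsCycleOn (Set.univ : Set (Fin m)))
    (B : Matrix (Fin m) (Fin m) R)
    (hB : ∀ i j : Fin m,
      B i j = if η j = i then (((-1 : Rˣ) ^ (n j) : Rˣ) : R) else 0) :
    (1 - t • B).det = 1 - (((-1 : Rˣ) ^ (∑ j, n j) : Rˣ) : R) * t ^ m := by
  have : Nonempty (Fin m) := ⟨⟨0, hm⟩⟩
  have htB : t • B = Matrix.of fun i j =>
      if η j = i then t * (((-1 : Rˣ) ^ (n j) : Rˣ) : R) else 0 := by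
    ext i j
    simp [hB]
  have hsum : (-1 : Rˣ) ^ (∑ j, n j) = ∏ j, (-1 : Rˣ) ^ n j := by
    induction (Finset.univ : Finset (Fin m)) using Finset.induction_on with
    | empty => simp
    | insert a s ha ih => rw [Finset.sum_insert ha, Finset.prod_insert ha, zpow_add, ih]
  rw [htB, Matrix.det_one_sub_of_isCycleOn hη, Finset.prod_mul_distrib, hsum, Units.coe_prod]
  simp [mul_comm]
end

section
/- Let R be a commutative ring, t ∈ R, m ≥ 1, let n₁, …, n_m be integers, and let η ∈ Σ_m be an arbitrary permutation. Let B be the m×m matrix over R with B_{ij} = (−1)^{n_j} if η(j) = i and B_{ij} = 0 otherwise. Then det(I − t·B) = ∏_c (1 − (−1)^{N_c}·t^{ℓ(c)}), where the product is over the cycles c of η (fixed points counting as cycles of length 1), ℓ(c) denotes the length of the cycle c, and N_c = Σ_{j ∈ c} n_j. -/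
namespace Equiv.Perm

variable {α R : Type*} [DecidableEq α] [CommRing R]

/-- The matrix of the permutation `f`, with column `j` scaled by `w j` and with the columns of
the fixed points of `f` replaced by zero. -/
def weightedMoveMatrix (f : Perm α) (w : α → R) : Matrix α α R :=
  Matrix.of fun i j => if f j = i ∧ f j ≠ j then w j else 0

theorem weightedMoveMatrix_apply (f : Perm α) (w : α → R) (i j : α) :
    f.weightedMoveMatrix w i j = if f j = i ∧ f j ≠ j then w j else 0 := rfl

theorem weightedMoveMatrix_one (w : α → R) : (1 : Perm α).weightedMoveMatrix w = 0 := by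
  ext i j
  simp [weightedMoveMatrix_apply]

variable [Fintype α]

theorem one_sub_weightedMoveMatrix_mul {f g : Perm α} (h : f.Disjoint g) (w : α → R) :
    1 - (f * g).weightedMoveMatrix w =
      (1 - f.weightedMoveMatrix w) * (1 - g.weightedMoveMatrix w) := by
  have h₀ : f.weightedMoveMatrix w * g.weightedMoveMatrix w = 0 := by
    ext i j
    rw [Matrix.mul_apply]
    refine Finset.sum_eq_zero fun k _ => ?_
    simp only [weightedMoveMatrix_apply]
    split_ifs with h₁ h₂ <;> try simp only [mul_zero, zero_mul]
    obtain ⟨rfl, hj⟩ := h₂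
    rcases h (g j) with hf | hg
    · exact absurd hf h₁.2
    · exact absurd (g.injective hg) hj
  have h₁ : (f * g).weightedMoveMatrix w = f.weightedMoveMatrix w + g.weightedMoveMatrix w := by
    ext i j
    simp only [Matrix.add_apply, weightedMoveMatrix_apply, mul_apply]
    rcases h j with hf | hg
    · have : f (g j) = g j := by
        rcases h (g j) with h' | h'
        · exact h'
        · rw [g.injective h', hf]
      simp [this, hf]
    · simp [hg]
  rw [h₁, sub_mul, mul_sub, mul_sub, h₀]
  simp only [one_mul, mul_one]
  abel

theorem IsCycle.eq_one_or_eq_of_forall {c : Perm α} (hc : c.IsCycle) {σ : Perm α}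
    (h : ∀ i, σ i = i ∨ σ i = c i) : σ = 1 ∨ σ = c := by
  by_contra! hne
  obtain ⟨h₁, h₂⟩ := hne
  obtain ⟨x, hx⟩ : ∃ x, σ x ≠ c x := by
    by_contra! h'
    exact h₂ (Equiv.ext h')
  have hσx : σ x = x := (h x).resolve_right hx
  have hcx : c x ≠ x := fun h' => hx (hσx.trans h'.symm)
  have hpow : ∀ k : ℕ, σ ((c⁻¹ ^ k) x) = (c⁻¹ ^ k) x := by
    intro k
    induction k with
    | zero => simpa using hσx
    | succ k ih =>
      rw [pow_succ', mul_apply]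
      refine (h _).resolve_right fun h' => ?_
      have h₃ : c (c⁻¹ ((c⁻¹ ^ k) x)) = (c⁻¹ ^ k) x := c.apply_symm_apply _
      have h₄ : c⁻¹ ((c⁻¹ ^ k) x) = (c⁻¹ ^ k) x :=
        σ.injective (h'.trans (h₃.trans ih.symm))
      rw [h₄] at h₃
      have h₅ : (c * c⁻¹ ^ k) x = (c⁻¹ ^ k * c) x := by
        rw [((Commute.refl c).inv_right.pow_right k).eq]
      exact hcx ((c⁻¹ ^ k).injective (h₅.symm.trans h₃))
  refine h₁ (Equiv.ext fun y => ?_)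
  by_cases hy : c y = y
  · rcases h y with h' | h'
    · simpa using h'
    · simpa using h'.trans hy
  · obtain ⟨k, hk⟩ := (sameCycle_inv.2 (hc.sameCycle hcx hy)).exists_nat_pow_eq
    rw [← hk]
    exact hpow k

theorem IsCycle.det_one_sub_weightedMoveMatrix {c : Perm α} (hc : c.IsCycle) (w : α → R) :
    (1 - c.weightedMoveMatrix w).det = 1 - ∏ j ∈ c.support, w j := by
  have hentry : ∀ i j, (1 - c.weightedMoveMatrix w) i j =
      if i = j then 1 else if i = c j then -w j else 0 := by
    intro i j
    rw [Matrix.sub_apply, Matrix.one_apply, weightedMoveMatrix_apply]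
    grind
  rw [Matrix.det_apply', ← Finset.sum_subset (Finset.subset_univ {1, c}),
    Finset.sum_pair hc.ne_one.symm]
  · have hprod : ∏ i, (1 - c.weightedMoveMatrix w) (c i) i = ∏ i ∈ c.support, -w i := by
      rw [← Finset.prod_subset (Finset.subset_univ c.support)]
      · refine Finset.prod_congr rfl fun i hi => ?_
        rw [hentry, if_neg (mem_support.1 hi), if_pos rfl]
      · intro i _ hi
        rw [hentry, if_pos (notMem_support.1 hi)]
    rw [hprod, hc.sign, Finset.prod_neg]
    simp only [hentry, sign_one, one_apply, if_true, Finset.prod_const_one]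
    push_cast
    have : ((-1 : R) ^ c.support.card) * (-1) ^ c.support.card = 1 := by
      rw [← mul_pow]; simp
    linear_combination (-∏ j ∈ c.support, w j) * this
  · intro σ _ hσ
    have : ∃ i, ¬ (σ i = i ∨ σ i = c i) := by
      by_contra! h
      rcases hc.eq_one_or_eq_of_forall h with rfl | rfl <;> simp at hσ
    obtain ⟨i, hi⟩ := this
    push Not at hi
    rw [Finset.prod_eq_zero (Finset.mem_univ i), mul_zero]
    rw [hentry, if_neg hi.1, if_neg hi.2]

theorem det_one_sub_weightedMoveMatrix (f : Perm α) (w : α → R) :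
    (1 - f.weightedMoveMatrix w).det =
      ∏ c ∈ f.cycleFactorsFinset, (1 - ∏ j ∈ c.support, w j) := by
  induction f using cycle_induction_on with
  | base_one => simp [weightedMoveMatrix_one]
  | base_cycles c hc =>
    rw [hc.det_one_sub_weightedMoveMatrix, hc.cycleFactorsFinset_eq_singleton,
      Finset.prod_singleton]
  | induction_disjoint f g h _ hf hg =>
    rw [one_sub_weightedMoveMatrix_mul h, Matrix.det_mul, hf, hg,
      h.cycleFactorsFinset_mul_eq_union,
      Finset.prod_union h.disjoint_cycleFactorsFinset]

/-- The determinant of `1 - P`, where `P` is the matrix of a permutation with column `j` scaled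
by `w j`, is a product over the cycles, fixed points included. -/
theorem det_one_sub_weighted_permMatrix (f : Perm α) (w : α → R) :
    (1 - Matrix.of fun i j => if f j = i then w j else 0).det =
      (∏ c ∈ f.cycleFactorsFinset, (1 - ∏ j ∈ c.support, w j)) *
        ∏ j with f j = j, (1 - w j) := by
  have hfactor : (1 - Matrix.of fun i j => if f j = i then w j else 0) =
      (1 - f.weightedMoveMatrix w) *
        Matrix.diagonal fun j => if f j = j then 1 - w j else 1 := by
    ext i j
    rw [Matrix.mul_diagonal, Matrix.sub_apply, Matrix.sub_apply, Matrix.one_apply,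
      weightedMoveMatrix_apply, Matrix.of_apply]
    grind
  rw [hfactor, Matrix.det_mul, Matrix.det_diagonal, det_one_sub_weightedMoveMatrix,
    Finset.prod_filter]

end Equiv.Perm


/-- Let `η ∈ Σ_m` be an arbitrary permutation, `n₁, …, n_m` integers, and `B` the
`m × m` matrix over a commutative ring `R` with `B i j = (-1)^(n j)` if `η j = i` and
`B i j = 0` otherwise.  Then `det(I - t • B) = ∏_c (1 - (-1)^(N_c) * t^(ℓ(c)))`, the
product running over the cycles `c` of `η` — fixed points counting as cycles of
length `1` — where `ℓ(c)` is the length of `c` and `N_c = ∑_{j ∈ c} n_j`.  (The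
nontrivial cycles of `η` are the elements of `η.cycleFactorsFinset`, each with
support `c.support` of cardinality `ℓ(c)`; the fixed points of `η` contribute the
length-one cycle factors.) -/
theorem det_one_sub_smul_perm_matrix {R : Type*} [CommRing R] (t : R)
    (m : ℕ) (hm : 1 ≤ m) (n : Fin m → ℤ) (η : Equiv.Perm (Fin m))
    (B : Matrix (Fin m) (Fin m) R)
    (hB : ∀ i j : Fin m,
      B i j = if η j = i then (((-1 : Rˣ) ^ (n j) : Rˣ) : R) else 0) :
    (1 - t • B).det =
      (∏ c ∈ η.cycleFactorsFinset,
        (1 - (((-1 : Rˣ) ^ (∑ j ∈ c.support, n j) : Rˣ) : R) * t ^ c.support.card)) *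
      (∏ j ∈ Finset.univ.filter (fun j : Fin m => η j = j),
        (1 - (((-1 : Rˣ) ^ (n j) : Rˣ) : R) * t)) := by
  have hw : 1 - t • B = 1 - Matrix.of fun i j =>
      if η j = i then (((-1 : Rˣ) ^ (n j) : Rˣ) : R) * t else 0 := by
    ext i j
    simp [hB, mul_comm]
  have hprod : ∀ s : Finset (Fin m), ((-1 : Rˣ) ^ (∑ j ∈ s, n j)) =
      ∏ j ∈ s, (-1 : Rˣ) ^ (n j) := by
    intro s
    induction s using Finset.induction_on with
    | empty => simp
    | insert a s ha ih => rw [Finset.sum_insert ha, Finset.prod_insert ha, zpow_add, ih]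
  rw [hw, Equiv.Perm.det_one_sub_weighted_permMatrix]
  congr 1
  refine Finset.prod_congr rfl fun c _ => ?_
  rw [Finset.prod_mul_distrib, Finset.prod_const, hprod, Units.coe_prod]
end

section
/- Let λ > 1 be a real number, m ≥ 1, let n₁, …, n_m be integers and η ∈ Σ_m a permutation. Let B be the m×m real matrix with B_{ij} = (−1)^{n_j} if η(j) = i and B_{ij} = 0 otherwise, and let A be the (2m)×(2m) block-diagonal real matrix with diagonal blocks λ·B and λ⁻¹·B. Then det(I − A) ≠ 0 and the sign of det(I − A) equals (−1)^m · (−1)^{n₁+⋯+n_m} · sgn(η). -/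
/-- A contraction `t • B` with `B` orthogonal and `t ^ 2 < 1` has no eigenvalue `1`. -/
theorem det_one_sub_smul_ne_zero_of_transpose_mul_self {ι : Type*} [Fintype ι] [DecidableEq ι]
    {B : Matrix ι ι ℝ} (hB : B.transpose * B = 1) {t : ℝ} (ht : t ^ 2 < 1) :
    (1 - t • B).det ≠ 0 := by
  intro h
  obtain ⟨v, hv, hv'⟩ := Matrix.exists_mulVec_eq_zero_iff.mpr h
  rw [Matrix.sub_mulVec, Matrix.one_mulVec, Matrix.smul_mulVec, sub_eq_zero] at hv'
  have hnorm : B.mulVec v ⬝ᵥ B.mulVec v = v ⬝ᵥ v := by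
    rw [Matrix.dotProduct_mulVec, Matrix.vecMul_mulVec, hB, Matrix.vecMul_one]
  have hself : v ⬝ᵥ v = t ^ 2 * (v ⬝ᵥ v) := by
    conv_lhs => rw [hv']
    rw [smul_dotProduct, dotProduct_smul, hnorm, smul_eq_mul, smul_eq_mul]
    ring
  refine hv (dotProduct_self_eq_zero.mp ?_)
  have hzero : (1 - t ^ 2) * (v ⬝ᵥ v) = 0 := by linarith
  exact (mul_eq_zero.mp hzero).resolve_left (by linarith)

/-- For `B` orthogonal, `1 - l • B` is `-l • B` times the transpose of `1 - l⁻¹ • B`. -/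
theorem det_one_sub_smul_of_transpose_mul_self {ι : Type*} [Fintype ι] [DecidableEq ι]
    {B : Matrix ι ι ℝ} (hB : B.transpose * B = 1) {l : ℝ} (hl : l ≠ 0) :
    (1 - l • B).det = (-l) ^ Fintype.card ι * B.det * (1 - l⁻¹ • B).det := by
  have hB' : B * B.transpose = 1 := mul_eq_one_comm.mp hB
  have hfac : 1 - l • B = ((-l) • B) * (1 - l⁻¹ • B).transpose := by
    rw [Matrix.transpose_sub, Matrix.transpose_one, Matrix.transpose_smul, mul_sub, mul_one,
      smul_mul_smul_comm, hB', neg_mul, mul_inv_cancel₀ hl, neg_smul, neg_smul, one_smul]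
    abel
  rw [hfac, Matrix.det_mul, Matrix.det_transpose, Matrix.det_smul]

/-- The determinant of a generalized permutation matrix. -/
theorem det_of_ite_perm {ι R : Type*} [Fintype ι] [DecidableEq ι] [CommRing R]
    (η : Equiv.Perm ι) (c : ι → R) :
    (Matrix.of fun i j => if η j = i then c j else 0).det =
      (∏ j, c j) * ((Equiv.Perm.sign η : ℤ) : R) := by
  have hfac : (Matrix.of fun i j => if η j = i then c j else 0).transpose =
      Matrix.diagonal c * η.permMatrix R := by
    ext i j
    simp [Matrix.diagonal_mul, Equiv.Perm.permMatrix, PEquiv.toMatrix_apply]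
  rw [← Matrix.det_transpose, hfac, Matrix.det_mul, Matrix.det_diagonal, Matrix.det_permutation]

/-- Let `l > 1` be real, `n₁, …, n_m` integers, `η ∈ Σ_m` a permutation, `B` the real
`m × m` matrix with `B i j = (-1)^(n j)` if `η j = i` and `0` otherwise, and `A` the
`2m × 2m` block-diagonal matrix with blocks `l • B` and `l⁻¹ • B`.  Then
`det(I - A) ≠ 0` and `sgn det(I - A) = (-1)^m (-1)^(n₁+⋯+n_m) sgn η`. -/
theorem sign_det_one_sub_hyperbolic {l : ℝ} (hl : 1 < l)
    (m : ℕ) (hm : 1 ≤ m) (n : Fin m → ℤ) (η : Equiv.Perm (Fin m))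
    (B : Matrix (Fin m) (Fin m) ℝ)
    (hB : ∀ i j : Fin m,
      B i j = if η j = i then (((-1 : ℝˣ) ^ (n j) : ℝˣ) : ℝ) else 0)
    (A : Matrix (Fin m ⊕ Fin m) (Fin m ⊕ Fin m) ℝ)
    (hA : A = Matrix.fromBlocks (l • B) 0 0 (l⁻¹ • B)) :
    (1 - A).det ≠ 0 ∧
    Real.sign (1 - A).det =
      (-1 : ℝ) ^ m * (((-1 : ℝˣ) ^ (∑ j, n j) : ℝˣ) : ℝ) *
        ((Equiv.Perm.sign η : ℤ) : ℝ) := by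
  have hl0 : 0 < l := by linarith
  set c : Fin m → ℝ := fun j => (((-1 : ℝˣ) ^ (n j) : ℝˣ) : ℝ) with hc
  have hcc : ∀ j, c j * c j = 1 := fun j => by
    simp only [hc, ← Units.val_mul, ← mul_zpow]
    simp
  have hBof : B = Matrix.of fun i j => if η j = i then c j else 0 := by
    ext i j
    exact hB i j
  have horth : B.transpose * B = 1 := by
    ext i j
    rw [hBof, Matrix.mul_apply, Matrix.one_apply]
    by_cases hij : i = j
    · subst hij
      simp [hcc]
    · simp [hij]
  have hprod : ∏ j, c j = (((-1 : ℝˣ) ^ (∑ j, n j) : ℝˣ) : ℝ) := by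
    have hsum : ∀ s : Finset (Fin m),
        ∏ j ∈ s, c j = (((-1 : ℝˣ) ^ (∑ j ∈ s, n j) : ℝˣ) : ℝ) := fun s => by
      induction s using Finset.induction_on with
      | empty => simp
      | insert a s ha ih =>
        rw [Finset.prod_insert ha, Finset.sum_insert ha, ih, zpow_add, Units.val_mul]
    exact hsum Finset.univ
  have hdetB : B.det = (((-1 : ℝˣ) ^ (∑ j, n j) : ℝˣ) : ℝ) *
      ((Equiv.Perm.sign η : ℤ) : ℝ) := by
    rw [hBof, det_of_ite_perm, hprod]
  have hinv : l⁻¹ ^ 2 < 1 :=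
    pow_lt_one₀ (inv_nonneg.mpr hl0.le) (inv_lt_one_of_one_lt₀ hl) two_ne_zero
  have hd := det_one_sub_smul_ne_zero_of_transpose_mul_self horth hinv
  have hdetA : (1 - A).det = (-1 : ℝ) ^ m * B.det * (l ^ m * (1 - l⁻¹ • B).det ^ 2) := by
    have hblock : 1 - A = Matrix.fromBlocks (1 - l • B) 0 0 (1 - l⁻¹ • B) := by
      rw [hA, ← Matrix.fromBlocks_one, sub_eq_add_neg, Matrix.fromBlocks_neg, Matrix.fromBlocks_add,
        neg_zero, add_zero, ← sub_eq_add_neg, ← sub_eq_add_neg]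
    rw [hblock, Matrix.det_fromBlocks_zero₂₁,
      det_one_sub_smul_of_transpose_mul_self horth hl0.ne', Fintype.card_fin, neg_pow l]
    ring
  have hpos : 0 < l ^ m * (1 - l⁻¹ • B).det ^ 2 := by positivity
  have hsq : ((-1 : ℝ) ^ m * B.det) ^ 2 = 1 := by
    have hdet := congrArg Matrix.det horth
    rw [Matrix.det_mul, Matrix.det_transpose, Matrix.det_one] at hdet
    rw [mul_pow, ← pow_mul, mul_comm m 2, pow_mul, neg_one_sq, one_pow, one_mul, sq, hdet]
  rw [mul_assoc, ← hdetB, hdetA]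
  rcases eq_or_eq_neg_of_sq_eq_sq _ 1 (hsq.trans (one_pow 2).symm) with h | h
  · rw [h, one_mul]
    exact ⟨hpos.ne', Real.sign_of_pos hpos⟩
  · rw [h, neg_one_mul]
    exact ⟨(neg_neg_of_pos hpos).ne, Real.sign_of_neg (neg_neg_of_pos hpos)⟩
end

section
/- In the ring of 3×3 matrices over the integral group ring ℤB₅, define M₁ = σ₁·[[−A_{1,4}A_{1,5}σ₄, −A_{1,4}A_{1,5}, A_{1,4}A_{1,5}], [0, −A_{1,5}, A_{1,5}(1−σ₄)], [0, 0, 1]], N₁ = [[−σ₄⁻¹A_{1,5}⁻¹A_{1,4}⁻¹, σ₄⁻¹A_{1,5}⁻¹, 1], [0, −A_{1,5}⁻¹, 1−σ₄], [0, 0, 1]]·σ₁⁻¹, M₂ = σ₂·[[1, 0, 0], [1−σ₄, −A_{2,4}, 0], [1, −A_{2,4}, −A_{2,4}A_{2,5}σ₄]], and N₂ = [[1, 0, 0], [A_{2,4}⁻¹(1−σ₄), −A_{2,4}⁻¹, 0], [A_{2,5}⁻¹A_{2,4}⁻¹, σ₄⁻¹A_{2,5}⁻¹A_{2,4}⁻¹,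 −σ₄⁻¹A_{2,5}⁻¹A_{2,4}⁻¹]]·σ₂⁻¹, where a scalar left or right factor multiplies every entry. Then M₁N₁ = N₁M₁ = I, M₂N₂ = N₂M₂ = I, and M₁M₂M₁ = M₂M₁M₂. Consequently there is a unique group homomorphism ζ_{3,2} : B₃ → GL₃(ℤB₅) with ζ_{3,2}(σ₁) = M₁ and ζ_{3,2}(σ₂) = M₂. -/
/-- The braid relations on `m` generators `σ_1, …, σ_m` (0-indexed as `Fin m`):
`σ_i σ_j = σ_j σ_i` for `|i - j| ≥ 2` and `σ_i σ_{i+1} σ_i = σ_{i+1} σ_i σ_{i+1}`. -/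
def braidRels (m : ℕ) : Set (FreeGroup (Fin m)) :=
  {r | ∃ i j : Fin m, ((i : ℕ) + 2 ≤ j ∨ (j : ℕ) + 2 ≤ i) ∧
      r = FreeGroup.of i * FreeGroup.of j * (FreeGroup.of i)⁻¹ * (FreeGroup.of j)⁻¹} ∪
  {r | ∃ i j : Fin m, (j : ℕ) = (i : ℕ) + 1 ∧
      r = FreeGroup.of i * FreeGroup.of j * FreeGroup.of i *
          (FreeGroup.of j)⁻¹ * (FreeGroup.of i)⁻¹ * (FreeGroup.of j)⁻¹}

/-- `Braid m` is the braid group on `m + 1` strands, presented with `m` generators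
`σ_1, …, σ_m` and the braid relations.  Thus `B_n = Braid (n - 1)`. -/
def Braid (m : ℕ) : Type := PresentedGroup (braidRels m)

instance (m : ℕ) : Group (Braid m) := by unfold Braid; infer_instance

/-- The generator `σ_{i+1}` (1-indexed) of the braid group `Braid m = B_{m+1}`,
for `i : Fin m` (0-indexed). -/
def braidGen (m : ℕ) (i : Fin m) : Braid m := PresentedGroup.of i

/-- The standard pure braid `A_{i,j} = σ_{j-1} ⋯ σ_{i+1} σ_i² σ_{i+1}⁻¹ ⋯ σ_{j-1}⁻¹`
(1-indexed, `1 ≤ i < j ≤ m + 1`) in the braid group `Braid m = B_{m+1}`. -/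
def pureBraid (m i j : ℕ) (hi : 1 ≤ i) (hij : i < j) (hj : j ≤ m + 1) : Braid m :=
  let w : Braid m :=
    ((List.range (j - 1 - i)).map (fun t => braidGen m ⟨j - 2 - t, by omega⟩)).prod
  w * (braidGen m ⟨i - 1, by omega⟩) ^ 2 * w⁻¹

namespace Zeta32

/-- The inclusion `B₅ → ℤB₅` of the braid group `B₅ = Braid 4` into its integral
group ring. -/
noncomputable def g : Braid 4 →* MonoidAlgebra ℤ (Braid 4) := MonoidAlgebra.of ℤ (Braid 4)

/-- `σ₁ ∈ B₅`. -/
def s1 : Braid 4 := braidGen 4 0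
/-- `σ₂ ∈ B₅`. -/
def s2 : Braid 4 := braidGen 4 1
/-- `σ₄ ∈ B₅`. -/
def s4 : Braid 4 := braidGen 4 3
/-- `A_{1,4} ∈ B₅`. -/
def a14 : Braid 4 := pureBraid 4 1 4 (by omega) (by omega) (by omega)
/-- `A_{1,5} ∈ B₅`. -/
def a15 : Braid 4 := pureBraid 4 1 5 (by omega) (by omega) (by omega)
/-- `A_{2,4} ∈ B₅`. -/
def a24 : Braid 4 := pureBraid 4 2 4 (by omega) (by omega) (by omega)
/-- `A_{2,5} ∈ B₅`. -/
def a25 : Braid 4 := pureBraid 4 2 5 (by omega) (by omega) (by omega)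

/-- `M₁ = σ₁·[[−A₁₄A₁₅σ₄, −A₁₄A₁₅, A₁₄A₁₅], [0, −A₁₅, A₁₅(1−σ₄)], [0, 0, 1]]`,
the scalar left factor multiplying every entry. -/
noncomputable def M1 : Matrix (Fin 3) (Fin 3) (MonoidAlgebra ℤ (Braid 4)) :=
  g s1 • !![-(g (a14 * a15 * s4)), -(g (a14 * a15)), g (a14 * a15);
            0, -(g a15), g a15 * (1 - g s4);
            0, 0, 1]

/-- `N₁ = [[−σ₄⁻¹A₁₅⁻¹A₁₄⁻¹, σ₄⁻¹A₁₅⁻¹, 1], [0, −A₁₅⁻¹, 1−σ₄], [0, 0, 1]]·σ₁⁻¹`,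
the scalar right factor multiplying every entry. -/
noncomputable def N1 : Matrix (Fin 3) (Fin 3) (MonoidAlgebra ℤ (Braid 4)) :=
  !![-(g (s4⁻¹ * a15⁻¹ * a14⁻¹)), g (s4⁻¹ * a15⁻¹), 1;
     0, -(g a15⁻¹), 1 - g s4;
     0, 0, 1] * Matrix.scalar (Fin 3) (g s1⁻¹)

/-- `M₂ = σ₂·[[1, 0, 0], [1−σ₄, −A₂₄, 0], [1, −A₂₄, −A₂₄A₂₅σ₄]]`. -/
noncomputable def M2 : Matrix (Fin 3) (Fin 3) (MonoidAlgebra ℤ (Braid 4)) :=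
  g s2 • !![1, 0, 0;
            1 - g s4, -(g a24), 0;
            1, -(g a24), -(g (a24 * a25 * s4))]

/-- `N₂ = [[1, 0, 0], [A₂₄⁻¹(1−σ₄), −A₂₄⁻¹, 0],
[A₂₅⁻¹A₂₄⁻¹, σ₄⁻¹A₂₅⁻¹A₂₄⁻¹, −σ₄⁻¹A₂₅⁻¹A₂₄⁻¹]]·σ₂⁻¹`. -/
noncomputable def N2 : Matrix (Fin 3) (Fin 3) (MonoidAlgebra ℤ (Braid 4)) :=
  !![1, 0, 0;
     g a24⁻¹ * (1 - g s4), -(g a24⁻¹), 0;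
     g (a25⁻¹ * a24⁻¹), g (s4⁻¹ * a25⁻¹ * a24⁻¹), -(g (s4⁻¹ * a25⁻¹ * a24⁻¹))] *
  Matrix.scalar (Fin 3) (g s2⁻¹)

section GroupIdentities

variable {G : Type*} [Group G] {x y z w b : G}

lemma conj_braid (h : x * y * x = y * x * y) : x * (y * x ^ 2 * y⁻¹) = y ^ 2 * x := by
  have : x * y * x * x = y * y * x * y := by
    rw [h, mul_assoc, mul_assoc, mul_assoc, ← mul_assoc x y x, h]
    simp only [mul_assoc]
  rw [← mul_assoc, mul_inv_eq_iff_eq_mul]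
  simpa only [pow_two, mul_assoc] using this

/-- `x` commutes with `y x² y`. -/
lemma braid_commute (h : x * y * x = y * x * y) :
    x * (y * x ^ 2 * y) = y * x ^ 2 * y * x := by
  calc x * (y * x ^ 2 * y) = (x * y * x) * (x * y) := by simp only [pow_two, mul_assoc]
    _ = y * x * (y * x * y) := by rw [h]; simp only [mul_assoc]
    _ = y * x ^ 2 * y * x := by rw [← h]; simp only [pow_two, mul_assoc]

lemma braid_sq_type_b (h : x * y * x = y * x * y) :
    y * x ^ 2 * y * x ^ 2 = x ^ 2 * y * x ^ 2 * y := by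
  have e := (show Commute x (y * x ^ 2 * y) from braid_commute h).pow_left 2
  simpa only [mul_assoc] using e.eq.symm

lemma inv_conj_braid (h : x * y * x = y * x * y) : x⁻¹ * y * x = y * x * y⁻¹ := by
  rw [eq_mul_inv_iff_mul_eq, mul_assoc, mul_assoc, ← mul_assoc y x y, ← h]
  group

/-- The four-term relation `x b x b = b x b x` passes from `(x, b)` to `(y, x b x⁻¹)` when `y`
braids with `x` and commutes with `b`. -/
lemma type_b_conj (hxb : x * b * x * b = b * x * b * x) (hxy : x * y * x = y * x * y)
    (hyb : y * b = b * y) :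
    y * (x * b * x⁻¹) * y * (x * b * x⁻¹) = x * b * x⁻¹ * y * (x * b * x⁻¹) * y := by
  have hb : y⁻¹ * b = b * y⁻¹ := (show Commute y b from hyb).inv_left.eq
  have hc := inv_conj_braid hxy
  calc y * (x * b * x⁻¹) * y * (x * b * x⁻¹)
      = y * x * b * (x⁻¹ * y * x) * b * x⁻¹ := by simp only [mul_assoc]
    _ = y * x * (b * y) * x * (y⁻¹ * b) * x⁻¹ := by rw [hc]; simp only [mul_assoc]
    _ = (y * x * y) * b * x * b * y⁻¹ * x⁻¹ := by rw [hb, ← hyb]; simp only [mul_assoc]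
    _ = x * y * (x * b * x * b) * y⁻¹ * x⁻¹ := by rw [← hxy]; simp only [mul_assoc]
    _ = x * (y * b) * x * b * (x * y⁻¹ * x⁻¹) := by rw [hxb]; simp only [mul_assoc]
    _ = x * (y * b) * x * b * (y⁻¹ * x⁻¹ * y) := by
        congr 1
        rw [eq_comm, mul_assoc, inv_mul_eq_iff_eq_mul, inv_mul_eq_iff_eq_mul]
        calc y = x * y * x * y⁻¹ * x⁻¹ := by rw [hxy]; group
          _ = _ := by simp only [mul_assoc]
    _ = x * b * (y * x * y⁻¹) * b * x⁻¹ * y := by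
        rw [hyb]; simp only [mul_assoc]; rw [← mul_assoc b y⁻¹, ← hb]; simp only [mul_assoc]
    _ = x * b * x⁻¹ * y * (x * b * x⁻¹) * y := by rw [← hc]; simp only [mul_assoc]

lemma commute_mul_conj (h : x * b * x * b = b * x * b * x) :
    x * (b * (x * b * x⁻¹)) = b * (x * b * x⁻¹) * x := by
  calc x * (b * (x * b * x⁻¹)) = x * b * x * b * x⁻¹ := by simp only [mul_assoc]
    _ = _ := by rw [h]; group

/-- For a braid chain `x, y, z`, the element `y` commutes with `z y x² y⁻¹ z⁻¹`. -/
lemma middle_commute (hyz : y * z * y = z * y * z) (hxz : x * z = z * x) :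
    y * (z * (y * x ^ 2 * y⁻¹) * z⁻¹) = z * (y * x ^ 2 * y⁻¹) * z⁻¹ * y := by
  have hz : z * x ^ 2 = x ^ 2 * z := ((show Commute x z from hxz).pow_left 2).eq.symm
  have e : z * y⁻¹ * z⁻¹ = y⁻¹ * z⁻¹ * y := by
    rw [eq_comm, mul_assoc, inv_mul_eq_iff_eq_mul, inv_mul_eq_iff_eq_mul]
    calc y = z * y * z * y⁻¹ * z⁻¹ := by rw [← hyz]; group
      _ = _ := by group
  calc y * (z * (y * x ^ 2 * y⁻¹) * z⁻¹) = (y * z * y) * x ^ 2 * y⁻¹ * z⁻¹ := by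
        simp only [mul_assoc]
    _ = z * y * (z * x ^ 2) * y⁻¹ * z⁻¹ := by rw [hyz]; simp only [mul_assoc]
    _ = z * y * x ^ 2 * (z * y⁻¹ * z⁻¹) := by rw [hz]; simp only [mul_assoc]
    _ = _ := by rw [e]; simp only [mul_assoc]

/-- For a braid chain `x, y, z, w`, the nested pure braids `A_{1,5}` and `A_{2,4}` commute. -/
lemma nested_commute (hyz : y * z * y = z * y * z) (hzw : z * w * z = w * z * w)
    (hxz : x * z = z * x) (hyw : y * w = w * y) (hxw : x * w = w * x) :
    Commute (w * (z * (y * x ^ 2 * y⁻¹) * z⁻¹) * w⁻¹) (z * y ^ 2 * z⁻¹) := by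
  have c1 : Commute (y * x ^ 2 * y⁻¹) (y * z ^ 2 * y⁻¹) :=
    ((show Commute x z from hxz).pow_pow 2 2).conj y
  have c2 : Commute (y * x ^ 2 * y⁻¹) w :=
    ((show Commute y w from hyw).mul_left ((show Commute x w from hxw).pow_left 2)).mul_left
      (show Commute y w from hyw).inv_left
  have e1 : z⁻¹ * y ^ 2 * z = y * z ^ 2 * y⁻¹ := by
    calc z⁻¹ * y ^ 2 * z = (z⁻¹ * y * z) ^ 2 := by simp only [pow_two]; group
      _ = (y * z * y⁻¹) ^ 2 := by rw [inv_conj_braid hyz.symm]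
      _ = _ := conj_pow
  have c3 : Commute (y * x ^ 2 * y⁻¹) (w * (y * z ^ 2 * y⁻¹) * w⁻¹) :=
    (c2.mul_right c1).mul_right c2.inv_right
  have e2 : (w * z) * (w * (y * z ^ 2 * y⁻¹) * w⁻¹) * (w * z)⁻¹ = z * y ^ 2 * z⁻¹ := by
    have hw : w * y ^ 2 * w⁻¹ = y ^ 2 := by
      rw [← ((show Commute y w from hyw).pow_left 2).eq, mul_inv_cancel_right]
    calc (w * z) * (w * (y * z ^ 2 * y⁻¹) * w⁻¹) * (w * z)⁻¹
        = (w * z * w) * (z⁻¹ * y ^ 2 * z) * (w * z * w)⁻¹ := by rw [e1]; group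
      _ = z * (w * y ^ 2 * w⁻¹) * z⁻¹ := by rw [← hzw]; group
      _ = _ := by rw [hw]
  have c4 := c3.conj (w * z)
  rw [e2] at c4
  convert c4 using 1
  group

end GroupIdentities

section RingIdentity

variable {R : Type*} [Ring R]

/-- The braid relation for the two matrices, from the relations among their entries;
`p` and `q` stand for `A_{1,4} A_{1,5}` and `A_{2,4} A_{2,5}`. -/
lemma matrix_braid {s t u p q a b : R} (hst : s * (t * s) = t * (s * t))
    (hus : u * s = s * u) (hut : u * t = t * u) (hup : u * p = p * u) (huq : u * q = q * u)
    (hbsa : b * (s * a) = s * p) (hpt : p * t = t * p) (hat : a * t = t * a)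
    (hqs : q * s = s * p) (hspq : s * (p * q) = p * (s * p))
    (hspub : s * (p * (u * b)) = a * (s * (p * u))) :
    (s • !![-(p * u), -p, p; 0, -a, a * (1 - u); 0, 0, 1] : Matrix (Fin 3) (Fin 3) R) *
        (t • !![1, 0, 0; 1 - u, -b, 0; 1, -b, -(q * u)]) *
        (s • !![-(p * u), -p, p; 0, -a, a * (1 - u); 0, 0, 1]) =
      (t • !![1, 0, 0; 1 - u, -b, 0; 1, -b, -(q * u)]) *
        (s • !![-(p * u), -p, p; 0, -a, a * (1 - u); 0, 0, 1]) *
        (t • !![1, 0, 0; 1 - u, -b, 0; 1, -b, -(q * u)]) := by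
  have two {x y v : R} (h : x * y = v) (z : R) : x * (y * z) = v * z := by
    rw [← mul_assoc, h]
  have three {x y y' v : R} (h : x * (y * y') = v) (z : R) : x * (y * (y' * z)) = v * z := by
    rw [← h]; simp only [mul_assoc]
  ext i j
  fin_cases i <;> fin_cases j <;>
    simp [Matrix.mul_apply, Fin.sum_univ_three, add_mul, mul_sub, sub_mul, mul_assoc,
      three hst.symm, hus, two hus, hut, two hut, hup, two hup, two huq, hbsa, three hbsa,
      hpt, two hpt, hat, two hat, two hqs, three hspq, hspub]
  all_goals abel

end RingIdentity

lemma braidGen_comm {m : ℕ} {i j : Fin m} (h : (i : ℕ) + 2 ≤ j) :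
    braidGen m i * braidGen m j = braidGen m j * braidGen m i := by
  have := PresentedGroup.one_of_mem (rels := braidRels m) (Or.inl ⟨i, j, Or.inl h, rfl⟩)
  rw [map_mul, map_mul, map_mul, map_inv, map_inv, mul_inv_eq_one, mul_inv_eq_iff_eq_mul] at this
  exact this

lemma braidGen_braid {m : ℕ} {i j : Fin m} (h : (j : ℕ) = i + 1) :
    braidGen m i * braidGen m j * braidGen m i = braidGen m j * braidGen m i * braidGen m j := by
  have := PresentedGroup.one_of_mem (rels := braidRels m) (Or.inr ⟨i, j, h, rfl⟩)
  simp only [map_mul, map_inv, mul_inv_eq_iff_eq_mul, one_mul] at this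
  exact this

/-- `σ₃ ∈ B₅`. -/
def s3 : Braid 4 := braidGen 4 2

lemma a14_eq : a14 = s3 * (s2 * s1 ^ 2 * s2⁻¹) * s3⁻¹ := by
  simp [a14, pureBraid, List.range_succ, s1, s2, s3, mul_assoc]

lemma a24_eq : a24 = s3 * s2 ^ 2 * s3⁻¹ := by
  simp [a24, pureBraid, s2, s3]

lemma a15_eq : a15 = s4 * a14 * s4⁻¹ := by
  simp [a14, a15, pureBraid, List.range_succ, s4, mul_assoc]

lemma a25_eq : a25 = s4 * a24 * s4⁻¹ := by
  simp [a24, a25, pureBraid, List.range_succ, s4, mul_assoc]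

lemma braid12 : s1 * s2 * s1 = s2 * s1 * s2 := braidGen_braid rfl
lemma braid23 : s2 * s3 * s2 = s3 * s2 * s3 := braidGen_braid rfl
lemma braid34 : s3 * s4 * s3 = s4 * s3 * s4 := braidGen_braid rfl
lemma comm13 : Commute s1 s3 := braidGen_comm (by decide)
lemma comm14 : Commute s1 s4 := braidGen_comm (by decide)
lemma comm24 : Commute s2 s4 := braidGen_comm (by decide)

lemma s1_mul_a14 : s1 * a14 = a24 * s1 := by
  rw [a14_eq, a24_eq, ← mul_assoc, ← mul_assoc, comm13.eq, mul_assoc s3, conj_braid braid12]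
  simp only [mul_assoc, comm13.inv_right.eq]

lemma s1_mul_a15 : s1 * a15 = a25 * s1 := by
  rw [a15_eq, a25_eq, ← mul_assoc, ← mul_assoc, comm14.eq, mul_assoc s4, s1_mul_a14]
  simp only [mul_assoc, comm14.inv_right.eq]

lemma commute_s2_a14 : Commute s2 a14 := by
  rw [a14_eq]
  exact middle_commute braid23 comm13

lemma commute_s2_a15 : Commute s2 a15 := by
  rw [a15_eq]
  exact (comm24.mul_right commute_s2_a14).mul_right comm24.inv_right

lemma commute_s4_a14_a15 : Commute s4 (a14 * a15) := by
  rw [a15_eq]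
  refine commute_mul_conj ?_
  have h := type_b_conj (braid_sq_type_b braid12) braid23
    (comm13.pow_left 2).symm
  rw [a14_eq]
  refine (type_b_conj h braid34 ?_)
  exact (((comm24.mul_left (comm14.pow_left 2)).mul_left comm24.inv_left).symm).eq

lemma commute_s4_a24_a25 : Commute s4 (a24 * a25) := by
  rw [a25_eq]
  refine commute_mul_conj ?_
  rw [a24_eq]
  exact type_b_conj (braid_sq_type_b braid23) braid34 (comm24.pow_left 2).symm

lemma commute_s1_a14_a24 : Commute s1 (a14 * a24) := by
  have e : a14 * a24 = s3 * (s2 * s1 ^ 2 * s2) * s3⁻¹ := by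
    rw [a14_eq, a24_eq]; group
  rw [e]
  exact (comm13.mul_right (braid_commute braid12)).mul_right comm13.inv_right

lemma commute_s1_a15_a25 : Commute s1 (a15 * a25) := by
  have e : a15 * a25 = s4 * (a14 * a24) * s4⁻¹ := by
    rw [a15_eq, a25_eq]; group
  rw [e]
  exact (comm14.mul_right commute_s1_a14_a24).mul_right comm14.inv_right

lemma commute_a15_a24 : Commute a15 a24 := by
  rw [a15_eq, a14_eq, a24_eq]
  exact nested_commute braid23 braid34 comm13 comm24 comm14

lemma a24_a25_mul_s1 : a24 * a25 * s1 = s1 * (a14 * a15) := by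
  rw [mul_assoc, ← s1_mul_a15, ← mul_assoc, ← s1_mul_a14, mul_assoc]

lemma s1_mul_a14_a15_a24_a25 :
    s1 * (a14 * a15 * (a24 * a25)) = a14 * a15 * (s1 * (a14 * a15)) := by
  have e : a14 * a15 * (a24 * a25) = a14 * a24 * (a15 * a25) := by
    rw [mul_assoc, ← mul_assoc a15, commute_a15_a24.eq]; simp only [mul_assoc]
  rw [← a24_a25_mul_s1, ← mul_assoc, ← mul_assoc _ _ s1, mul_assoc s1, e]
  exact (commute_s1_a14_a24.mul_right commute_s1_a15_a25).eq

lemma s1_mul_a14_a15_s4_a24 :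
    s1 * (a14 * a15 * (s4 * a24)) = a15 * (s1 * (a14 * a15 * s4)) := by
  have e : s4 * a24 = a25 * s4 := by rw [a25_eq, inv_mul_cancel_right]
  calc s1 * (a14 * a15 * (s4 * a24)) = s1 * a14 * (a15 * a25) * s4 := by
        rw [e]; simp only [mul_assoc]
    _ = a24 * (s1 * (a15 * a25)) * s4 := by rw [s1_mul_a14]; simp only [mul_assoc]
    _ = a24 * a15 * (a25 * s1) * s4 := by rw [commute_s1_a15_a25.eq]; simp only [mul_assoc]
    _ = a15 * (a24 * a25 * s1) * s4 := by rw [← commute_a15_a24.eq]; simp only [mul_assoc]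
    _ = _ := by rw [a24_a25_mul_s1]; simp only [mul_assoc]

lemma M1_mul_M2_mul_M1 : M1 * M2 * M1 = M2 * M1 * M2 := by
  have lift {x y : Braid 4} (h : x = y) : g x = g y := congrArg g h
  have h := matrix_braid (R := MonoidAlgebra ℤ (Braid 4)) (s := g s1) (t := g s2) (u := g s4)
    (p := g (a14 * a15)) (q := g (a24 * a25)) (a := g a15) (b := g a24)
  simp only [← map_mul] at h
  exact h (lift (by simpa only [mul_assoc] using braid12)) (lift comm14.symm) (lift comm24.symm)
    (lift commute_s4_a14_a15) (lift commute_s4_a24_a25)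
    (lift (by rw [← mul_assoc, ← s1_mul_a14, mul_assoc]))
    (lift (commute_s2_a14.mul_right commute_s2_a15).symm) (lift commute_s2_a15.symm)
    (lift a24_a25_mul_s1) (lift s1_mul_a14_a15_a24_a25) (lift s1_mul_a14_a15_s4_a24)

lemma g_mul_inv (x : Braid 4) : g x * g x⁻¹ = 1 := by rw [← map_mul, mul_inv_cancel, map_one]

lemma g_inv_mul (x : Braid 4) : g x⁻¹ * g x = 1 := by rw [← map_mul, inv_mul_cancel, map_one]

lemma g_mul_inv_mul (x : Braid 4) (r : MonoidAlgebra ℤ (Braid 4)) : g x * (g x⁻¹ * r) = r := by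
  rw [← mul_assoc, g_mul_inv, one_mul]

lemma g_inv_mul_mul (x : Braid 4) (r : MonoidAlgebra ℤ (Braid 4)) : g x⁻¹ * (g x * r) = r := by
  rw [← mul_assoc, g_inv_mul, one_mul]

lemma M1_mul_N1 : M1 * N1 = 1 := by
  ext1 i j
  fin_cases i <;> fin_cases j <;>
    simp [M1, N1, Matrix.mul_apply, Fin.sum_univ_three, mul_sub, sub_mul, mul_assoc,
      g_mul_inv, g_mul_inv_mul]

lemma N1_mul_M1 : N1 * M1 = 1 := by
  ext1 i j
  fin_cases i <;> fin_cases j <;>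
    simp [M1, N1, Matrix.mul_apply, Fin.sum_univ_three, mul_sub, sub_mul, mul_assoc,
      g_inv_mul, g_inv_mul_mul]
  abel

lemma g_s4_mul : g s4 * (g a24 * g a25) = g a24 * (g a25 * g s4) := by
  simpa only [map_mul, mul_assoc] using congrArg g commute_s4_a24_a25.eq

lemma M2_mul_N2 : M2 * N2 = 1 := by
  have h (r : MonoidAlgebra ℤ (Braid 4)) :
      g a24 * (g a25 * (g s4 * r)) = g s4 * (g a24 * (g a25 * r)) := by
    simpa only [mul_assoc] using congrArg (fun z => z * r) g_s4_mul.symm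
  ext1 i j
  fin_cases i <;> fin_cases j <;>
    simp [M2, N2, Matrix.mul_apply, Fin.sum_univ_three, mul_sub, sub_mul, mul_assoc,
      g_mul_inv, g_mul_inv_mul, h]

lemma N2_mul_M2 : N2 * M2 = 1 := by
  have h : g s4⁻¹ * (g a25⁻¹ * g a24⁻¹) = g a25⁻¹ * (g a24⁻¹ * g s4⁻¹) := by
    simpa only [map_mul, mul_inv_rev, mul_assoc] using
      congrArg g commute_s4_a24_a25.inv_inv.eq
  ext1 i j
  fin_cases i <;> fin_cases j <;>
    simp [M2, N2, Matrix.mul_apply, Fin.sum_univ_three, mul_sub, sub_mul, mul_assoc,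
      g_inv_mul, g_inv_mul_mul, h, g_s4_mul.symm]

/-- The universal property of `B₃`. -/
lemma existsUnique_braid_three_hom {H : Type*} [Group H] {a b : H} (h : a * b * a = b * a * b) :
    ∃! φ : Braid 2 →* H, φ (braidGen 2 0) = a ∧ φ (braidGen 2 1) = b := by
  have hr : ∀ r ∈ braidRels 2, FreeGroup.lift ![a, b] r = 1 := by
    rintro r (⟨i, j, hij, rfl⟩ | ⟨i, j, hij, rfl⟩)
    · omega
    · obtain rfl : i = 0 := by omega
      obtain rfl : j = 1 := by omega
      simp [h]
  refine ⟨PresentedGroup.toGroup hr, ⟨PresentedGroup.toGroup.of hr, PresentedGroup.toGroup.of hr⟩,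
    fun ψ hψ => PresentedGroup.ext fun i => ?_⟩
  refine Eq.trans ?_ (PresentedGroup.toGroup.of hr).symm
  fin_cases i
  exacts [hψ.1, hψ.2]

/-- The matrices `M₁, M₂` above are invertible (with explicit inverses `N₁, N₂`) and
satisfy the braid relation; consequently there is a unique group homomorphism
`ζ_{3,2} : B₃ → GL₃(ℤB₅)` with `ζ_{3,2}(σ₁) = M₁` and `ζ_{3,2}(σ₂) = M₂`. -/
theorem zeta_three_two :
    M1 * N1 = 1 ∧ N1 * M1 = 1 ∧ M2 * N2 = 1 ∧ N2 * M2 = 1 ∧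
    M1 * M2 * M1 = M2 * M1 * M2 ∧
    ∃! φ : Braid 2 →* (Matrix (Fin 3) (Fin 3) (MonoidAlgebra ℤ (Braid 4)))ˣ,
      (φ (braidGen 2 0)).val = M1 ∧ (φ (braidGen 2 1)).val = M2 := by
  refine ⟨M1_mul_N1, N1_mul_M1, M2_mul_N2, N2_mul_M2, M1_mul_M2_mul_M1, ?_⟩
  let u : (Matrix (Fin 3) (Fin 3) (MonoidAlgebra ℤ (Braid 4)))ˣ := ⟨M1, N1, M1_mul_N1, N1_mul_M1⟩
  let v : (Matrix (Fin 3) (Fin 3) (MonoidAlgebra ℤ (Braid 4)))ˣ := ⟨M2, N2, M2_mul_N2, N2_mul_M2⟩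
  have huv : u * v * u = v * u * v := by
    ext1
    simp only [Units.val_mul]
    exact M1_mul_M2_mul_M1
  obtain ⟨φ, hφ, hunique⟩ := existsUnique_braid_three_hom huv
  exact ⟨φ, ⟨congrArg Units.val hφ.1, congrArg Units.val hφ.2⟩,
    fun ψ hψ => hunique ψ ⟨Units.ext hψ.1, Units.ext hψ.2⟩⟩

end Zeta32
end

section
/- In the braid group B₆, let β = σ₁σ₂σ₃⁻¹σ₄⁻¹. Then β·A_{1,6} = A_{2,6}·β, and the element β·A_{2,6}·A_{5,6}⁻¹ is conjugate to β in B₆. -/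
theorem braidGen_commute (m : ℕ) (i j : Fin m) (h : (i : ℕ) + 2 ≤ j ∨ (j : ℕ) + 2 ≤ i) :
    Commute (braidGen m i) (braidGen m j) := by
  have hr : PresentedGroup.mk (braidRels m) (FreeGroup.of i * FreeGroup.of j *
      (FreeGroup.of i)⁻¹ * (FreeGroup.of j)⁻¹) = 1 :=
    PresentedGroup.one_of_mem (Or.inl ⟨i, j, h, rfl⟩)
  simp only [map_mul, map_inv] at hr
  rwa [mul_inv_eq_one, mul_inv_eq_iff_eq_mul] at hr

theorem braidGen_braid (m : ℕ) (i j : Fin m) (h : (j : ℕ) = (i : ℕ) + 1) :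
    braidGen m i * braidGen m j * braidGen m i =
      braidGen m j * braidGen m i * braidGen m j := by
  have hr : PresentedGroup.mk (braidRels m) (FreeGroup.of i * FreeGroup.of j * FreeGroup.of i *
      (FreeGroup.of j)⁻¹ * (FreeGroup.of i)⁻¹ * (FreeGroup.of j)⁻¹) = 1 :=
    PresentedGroup.one_of_mem (Or.inr ⟨i, j, h, rfl⟩)
  simp only [map_mul, map_inv] at hr
  rwa [mul_inv_eq_one, mul_inv_eq_iff_eq_mul, mul_inv_eq_iff_eq_mul] at hr

section BraidRelation

variable {G : Type*} [Group G] {w x y p q : G}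

theorem SemiconjBy.conj_of_commute (h : SemiconjBy x p q) (hw : Commute x w) :
    SemiconjBy x (w * p * w⁻¹) (w * q * w⁻¹) :=
  (SemiconjBy.mul_right hw h).mul_right hw.inv_right

theorem semiconjBy_sq_of_braid (h : x * y * x = y * x * y) :
    SemiconjBy x (y * x ^ 2 * y⁻¹) (y ^ 2) := by
  rw [SemiconjBy, ← mul_assoc, mul_inv_eq_iff_eq_mul]
  calc x * (y * x ^ 2) = x * y * x * x := by simp only [pow_two, mul_assoc]
    _ = y * x * y * x := by rw [h]
    _ = y * (x * y * x) := by simp only [mul_assoc]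
    _ = y ^ 2 * x * y := by rw [h]; simp only [pow_two, mul_assoc]

theorem commute_conj_sq_mul_sq_of_braid (h : x * y * x = y * x * y) :
    Commute x (y * x ^ 2 * y⁻¹ * y ^ 2) := by
  rw [commute_iff_eq]
  calc x * (y * x ^ 2 * y⁻¹ * y ^ 2) = x * y * x * x * y := by simp [pow_two, mul_assoc]
    _ = y * x * (y * x * y) := by rw [h]; simp only [mul_assoc]
    _ = y * x ^ 2 * y⁻¹ * y ^ 2 * x := by rw [← h]; simp [pow_two, mul_assoc]

theorem commute_conj_of_braid (h : x * y * x = y * x * y) (hp : Commute y p) :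
    Commute x (y * (x * p * x⁻¹) * y⁻¹) := by
  have hyx : SemiconjBy (y * x) y x := by
    rw [SemiconjBy, ← mul_assoc, h]
  rw [commute_iff_eq]
  calc x * (y * (x * p * x⁻¹) * y⁻¹) = x * (y * x) * p * (y * x)⁻¹ := by group
    _ = y * x * (y * p) * (y * x)⁻¹ := by rw [← hyx.eq]; group
    _ = y * x * p * (y * x)⁻¹ * (y * x * y * (y * x)⁻¹) := by rw [hp.eq]; group
    _ = y * (x * p * x⁻¹) * y⁻¹ * x := by rw [hyx.eq]; group

/-- If `x` sends `p` to `q` and fixes `p * q` under conjugation, then it sends `q` to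
`q⁻¹ * (p * q)`. -/
theorem SemiconjBy.of_commute_mul (h : SemiconjBy x p q) (hc : Commute x (p * q)) :
    SemiconjBy x q (q⁻¹ * (p * q)) := by
  simpa using h.inv_right.mul_right hc

end BraidRelation

/-- The two identities in any group containing a sequence of five elements that satisfy the
braid relations. -/
theorem beta_identities_of_braid {G : Type*} [Group G] {a b c d e : G}
    (hab : a * b * a = b * a * b) (hbc : b * c * b = c * b * c)
    (hcd : c * d * c = d * c * d) (hde : d * e * d = e * d * e)
    (hac : Commute a c) (had : Commute a d) (hae : Commute a e)
    (hbd : Commute b d) (hbe : Commute b e) (hce : Commute c e) :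
    a * b * c⁻¹ * d⁻¹ *
        (e * (d * (c * (b * a ^ 2 * b⁻¹) * c⁻¹) * d⁻¹) * e⁻¹) =
      e * (d * (c * b ^ 2 * c⁻¹) * d⁻¹) * e⁻¹ * (a * b * c⁻¹ * d⁻¹) ∧
    IsConj (a * b * c⁻¹ * d⁻¹)
      (a * b * c⁻¹ * d⁻¹ * (e * (d * (c * b ^ 2 * c⁻¹) * d⁻¹) * e⁻¹) * (e ^ 2)⁻¹) := by
  have e1 : Commute e (c * (b * a ^ 2 * b⁻¹) * c⁻¹) :=
    SemiconjBy.conj_of_commute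
      (SemiconjBy.conj_of_commute (hae.symm.pow_right 2) hbe.symm) hce.symm
  have d1 : Commute d (b * a ^ 2 * b⁻¹) :=
    SemiconjBy.conj_of_commute (had.symm.pow_right 2) hbd.symm
  have ab : SemiconjBy a (e * (d * (c * (b * a ^ 2 * b⁻¹) * c⁻¹) * d⁻¹) * e⁻¹)
      (e * (d * (c * b ^ 2 * c⁻¹) * d⁻¹) * e⁻¹) :=
    (((semiconjBy_sq_of_braid hab).conj_of_commute hac).conj_of_commute had).conj_of_commute hae
  have bA1 : Commute b (e * (d * (c * (b * a ^ 2 * b⁻¹) * c⁻¹) * d⁻¹) * e⁻¹) :=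
    ((commute_conj_of_braid hbc (hac.symm.pow_right 2)).conj_of_commute hbd).conj_of_commute hbe
  have cA1 : Commute c (e * (d * (c * (b * a ^ 2 * b⁻¹) * c⁻¹) * d⁻¹) * e⁻¹) :=
    (commute_conj_of_braid hcd d1).conj_of_commute hce
  have dA1 : Commute d (e * (d * (c * (b * a ^ 2 * b⁻¹) * c⁻¹) * d⁻¹) * e⁻¹) :=
    commute_conj_of_braid hde e1
  have cA2 : Commute c (e * (d * (c * b ^ 2 * c⁻¹) * d⁻¹) * e⁻¹) :=
    (commute_conj_of_braid hcd (hbd.symm.pow_right 2)).conj_of_commute hce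
  have dA2 : Commute d (e * (d * (c * b ^ 2 * c⁻¹) * d⁻¹) * e⁻¹) :=
    commute_conj_of_braid hde (SemiconjBy.conj_of_commute (hbe.symm.pow_right 2) hce.symm)
  have bA2 : SemiconjBy b (e * (d * (c * b ^ 2 * c⁻¹) * d⁻¹) * e⁻¹)
      (e * (d * c ^ 2 * d⁻¹) * e⁻¹) :=
    ((semiconjBy_sq_of_braid hbc).conj_of_commute hbd).conj_of_commute hbe
  have cA3 : SemiconjBy c (e * (d * c ^ 2 * d⁻¹) * e⁻¹) (e * d ^ 2 * e⁻¹) :=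
    (semiconjBy_sq_of_braid hcd).conj_of_commute hce
  have cA34 : Commute c (e * (d * c ^ 2 * d⁻¹) * e⁻¹ * (e * d ^ 2 * e⁻¹)) := by
    rw [conj_mul]
    exact SemiconjBy.conj_of_commute (commute_conj_sq_mul_sq_of_braid hcd) hce
  have dA3 : Commute d (e * (d * c ^ 2 * d⁻¹) * e⁻¹) :=
    commute_conj_of_braid hde (hce.symm.pow_right 2)
  have dA4 : SemiconjBy d (e * d ^ 2 * e⁻¹) (e ^ 2) := semiconjBy_sq_of_braid hde
  have dA45 : Commute d (e * d ^ 2 * e⁻¹ * e ^ 2) := commute_conj_sq_mul_sq_of_braid hde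
  have aA3 : Commute a (e * (d * c ^ 2 * d⁻¹) * e⁻¹) :=
    SemiconjBy.conj_of_commute (SemiconjBy.conj_of_commute (hac.pow_right 2) had) hae
  have aA4 : Commute a (e * d ^ 2 * e⁻¹) := SemiconjBy.conj_of_commute (had.pow_right 2) hae
  have bA4 : Commute b (e * d ^ 2 * e⁻¹) := SemiconjBy.conj_of_commute (hbd.pow_right 2) hbe
  have aA5 : Commute a (e ^ 2) := hae.pow_right 2
  have bA5 : Commute b (e ^ 2) := hbe.pow_right 2
  have cA5 : Commute c (e ^ 2) := hce.pow_right 2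
  generalize e * (d * (c * (b * a ^ 2 * b⁻¹) * c⁻¹) * d⁻¹) * e⁻¹ = A₁ at *
  generalize e * (d * (c * b ^ 2 * c⁻¹) * d⁻¹) * e⁻¹ = A₂ at *
  generalize e * (d * c ^ 2 * d⁻¹) * e⁻¹ = A₃ at *
  generalize e * d ^ 2 * e⁻¹ = A₄ at *
  generalize e ^ 2 = A₅ at *
  refine ⟨((ab.mul_left bA1).mul_left cA1.inv_left).mul_left dA1.inv_left, ?_⟩
  have hd : SemiconjBy d (A₂ * (A₄⁻¹ * A₃) * (A₄ * A₅)) (A₂ * (A₅⁻¹ * A₃) * (A₄ * A₅)) :=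
    (SemiconjBy.mul_right dA2 (dA4.inv_right.mul_right dA3)).mul_right dA45
  have hc : SemiconjBy c (A₂ * A₄ * A₅) (A₂ * (A₄⁻¹ * (A₃ * A₄)) * A₅) :=
    (SemiconjBy.mul_right cA2 (cA3.of_commute_mul cA34)).mul_right cA5
  have hb : SemiconjBy b (A₂ * A₄ * A₅) (A₃ * A₄ * A₅) := (bA2.mul_right bA4).mul_right bA5
  have ha : Commute a (A₃ * A₄ * A₅) := (aA3.mul_right aA4).mul_right aA5
  have hc' : SemiconjBy c⁻¹ (A₂ * (A₄⁻¹ * A₃) * (A₄ * A₅)) (A₂ * A₄ * A₅) := by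
    simpa only [mul_assoc] using hc.inv_symm_left
  have key := ((SemiconjBy.mul_left ha hb).mul_left hc').mul_left hd.inv_symm_left
  refine isConj_iff.mpr ⟨A₃ * A₄ * A₅, ?_⟩
  rw [mul_inv_eq_iff_eq_mul, ← key.eq]
  group

/-- In `B₆ = Braid 5`, with `β = σ₁σ₂σ₃⁻¹σ₄⁻¹`, we have `β·A_{1,6} = A_{2,6}·β`, and
`β·A_{2,6}·A_{5,6}⁻¹` is conjugate to `β` in `B₆`. -/
theorem beta_identities_B6 :
    (braidGen 5 0 * braidGen 5 1 * (braidGen 5 2)⁻¹ * (braidGen 5 3)⁻¹) *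
        pureBraid 5 1 6 (by omega) (by omega) (by omega) =
      pureBraid 5 2 6 (by omega) (by omega) (by omega) *
        (braidGen 5 0 * braidGen 5 1 * (braidGen 5 2)⁻¹ * (braidGen 5 3)⁻¹) ∧
    IsConj (braidGen 5 0 * braidGen 5 1 * (braidGen 5 2)⁻¹ * (braidGen 5 3)⁻¹)
      ((braidGen 5 0 * braidGen 5 1 * (braidGen 5 2)⁻¹ * (braidGen 5 3)⁻¹) *
        pureBraid 5 2 6 (by omega) (by omega) (by omega) *
        (pureBraid 5 5 6 (by omega) (by omega) (by omega))⁻¹) := by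
  have hA5 : pureBraid 5 5 6 (by omega) (by omega) (by omega) = braidGen 5 4 ^ 2 := by
    simp [pureBraid]
  have hA2 : pureBraid 5 2 6 (by omega) (by omega) (by omega) =
      braidGen 5 4 * (braidGen 5 3 * (braidGen 5 2 * braidGen 5 1 ^ 2 * (braidGen 5 2)⁻¹) *
        (braidGen 5 3)⁻¹) * (braidGen 5 4)⁻¹ := by
    simp [pureBraid, List.range_succ, mul_assoc]
  have hA1 : pureBraid 5 1 6 (by omega) (by omega) (by omega) =
      braidGen 5 4 * (braidGen 5 3 * (braidGen 5 2 * (braidGen 5 1 * braidGen 5 0 ^ 2 *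
        (braidGen 5 1)⁻¹) * (braidGen 5 2)⁻¹) * (braidGen 5 3)⁻¹) * (braidGen 5 4)⁻¹ := by
    simp [pureBraid, List.range_succ, mul_assoc]
  rw [hA5, hA2, hA1]
  exact beta_identities_of_braid (braidGen_braid 5 0 1 rfl) (braidGen_braid 5 1 2 rfl)
    (braidGen_braid 5 2 3 rfl) (braidGen_braid 5 3 4 rfl)
    (braidGen_commute 5 0 2 (by decide)) (braidGen_commute 5 0 3 (by decide))
    (braidGen_commute 5 0 4 (by decide)) (braidGen_commute 5 1 3 (by decide))
    (braidGen_commute 5 1 4 (by decide)) (braidGen_commute 5 2 4 (by decide))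
end
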